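/- arXiv:1301.2449 — 4 statements merged into one kernel-verified Lean document; each statement's English description precedes it below -/
import Mathlib

section
/- Let C be a nonempty open convex cone in ℝ^n, and let F be an analytic function on the tube C + iℝ^n ⊆ ℂ^n that is real-valued and strictly positive on C. If there exists β > 0 such that the function x ↦ F(x)^{-β} is completely monotone on C, then F is nonvanishing on the tube C + iℝ^n. -/
/-- Complete monotonicity on an (open convex cone) subset `C` of a real normed space:
`f` is `C^∞` on `C` and `(−1)^k D_{u_1}···D_{u_k} f(x) ≥ 0` for all `k ≥ 0`, all
directions `u_1, …, u_k ∈ C` and all `x ∈ C`. -/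
def CompletelyMonotoneOn {E : Type*} [NormedAddCommGroup E] [NormedSpace ℝ E]
    (f : E → ℝ) (C : Set E) : Prop :=
  ContDiffOn ℝ (⊤ : ℕ∞) f C ∧
    ∀ (k : ℕ) (u : Fin k → E), (∀ i, u i ∈ C) → ∀ x ∈ C,
      0 ≤ (-1 : ℝ) ^ k * iteratedFDerivWithin ℝ k f C x u

/-- The tube `C + iℝ^n ⊆ ℂ^n` over a set `C ⊆ ℝ^n`: those `z` whose coordinatewise real
part lies in `C`. -/
def tube {n : ℕ} (C : Set (Fin n → ℝ)) : Set (Fin n → ℂ) :=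
  {z | (fun i => (z i).re) ∈ C}

open Set Filter Topology
open scoped ContDiff Nat

section AbsoluteMonotonicity

variable {E : Type*} [NormedAddCommGroup E] [NormedSpace ℝ E]

/-- The chain rule for signed higher derivatives along the curve `r ↦ P - r • v - r ^ m • w`. -/
theorem hasDerivAt_signed_iteratedFDerivWithin_comp {g : E → ℝ} {C : Set E} (hC : IsOpen C)
    (hg : ContDiffOn ℝ ∞ g C) (P v w : E) (m k : ℕ) (u : Fin k → E) {r : ℝ}
    (hr : P - r • v - r ^ m • w ∈ C) :
    HasDerivAt
      (fun r : ℝ => (-1 : ℝ) ^ k * iteratedFDerivWithin ℝ k g C (P - r • v - r ^ m • w) u)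
      ((-1 : ℝ) ^ (k + 1) * iteratedFDerivWithin ℝ (k + 1) g C (P - r • v - r ^ m • w)
          (Fin.cons v u : Fin (k + 1) → E) +
        m * (r ^ (m - 1) * ((-1 : ℝ) ^ (k + 1) * iteratedFDerivWithin ℝ (k + 1) g C
          (P - r • v - r ^ m • w) (Fin.cons w u : Fin (k + 1) → E)))) r := by
  have hd : HasFDerivAt (iteratedFDerivWithin ℝ k g C)
      (fderivWithin ℝ (iteratedFDerivWithin ℝ k g C) C (P - r • v - r ^ m • w))
      (P - r • v - r ^ m • w) :=
    ((hg.differentiableOn_iteratedFDerivWithin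
      (mod_cast WithTop.coe_lt_coe.2 (ENat.natCast_lt_top k)) hC.uniqueDiffOn) _
        hr).hasFDerivWithinAt.hasFDerivAt (hC.mem_nhds hr)
  have hp : HasDerivAt (fun r : ℝ => P - r • v - r ^ m • w)
      (-v - (m * r ^ (m - 1)) • w) r := by
    simpa using! (((hasDerivAt_id r).smul_const v).const_sub P).sub
      ((hasDerivAt_pow m r).smul_const w)
  have h1 := hd.comp_hasDerivAt r hp
  have h2 := ((ContinuousMultilinearMap.apply ℝ (fun _ : Fin k => E) ℝ
    u).hasFDerivAt.comp_hasDerivAt r h1).const_mul ((-1 : ℝ) ^ k)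
  refine h2.congr_deriv ?_
  simp only [iteratedFDerivWithin_succ_apply_left, Fin.cons_zero, Fin.tail_cons,
    ContinuousMultilinearMap.apply_apply, map_sub, map_neg, map_smul, smul_eq_mul]
  ring

theorem iteratedDerivWithin_pow_mul_comp_nonneg {g : E → ℝ} {C : Set E} (hC : IsOpen C)
    (hg : CompletelyMonotoneOn g C) {P v w : E} (hv : v ∈ C) (hw : w ∈ C) (m : ℕ) {b : ℝ}
    (hb : 0 < b) (hP : ∀ r ∈ Icc 0 b, P - r • v - r ^ m • w ∈ C) (N : ℕ) :
    ∀ (j k : ℕ) (u : Fin k → E), (∀ i, u i ∈ C) → ∀ r ∈ Icc 0 b,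
      0 ≤ iteratedDerivWithin N (fun r : ℝ => r ^ j * ((-1 : ℝ) ^ k *
        iteratedFDerivWithin ℝ k g C (P - r • v - r ^ m • w) u)) (Icc 0 b) r := by
  have huniq : UniqueDiffOn ℝ (Icc 0 b) := uniqueDiffOn_Icc hb
  have hsm : ∀ (j k : ℕ) (u : Fin k → E), ContDiffOn ℝ ∞ (fun r : ℝ => r ^ j * ((-1 : ℝ) ^ k *
        iteratedFDerivWithin ℝ k g C (P - r • v - r ^ m • w) u)) (Icc 0 b) := by
    intro j k u
    have h1 : ContDiffOn ℝ ∞ (iteratedFDerivWithin ℝ k g C) C := fun x hx =>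
      (hg.1 x hx).iteratedFDerivWithin_right hC.uniqueDiffOn (by exact_mod_cast le_top) hx
    have h2 : ContDiffOn ℝ ∞ (fun r : ℝ => P - r • v - r ^ m • w) (Icc 0 b) := by
      apply ContDiff.contDiffOn
      fun_prop
    have h3 := (ContinuousMultilinearMap.apply ℝ (fun _ : Fin k => E) ℝ u).contDiff.comp_contDiffOn
      (h1.comp h2 hP)
    exact (contDiff_id.pow j).contDiffOn.mul (contDiffOn_const.mul h3)
  induction N with
  | zero =>
    intro j k u hu r hr
    simpa using mul_nonneg (pow_nonneg hr.1 j) (hg.2 k u hu _ (hP r hr))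
  | succ N ih =>
    intro j k u hu r hr
    rw [iteratedDerivWithin_succ']
    have hderiv : EqOn (derivWithin (fun r : ℝ => r ^ j * ((-1 : ℝ) ^ k *
        iteratedFDerivWithin ℝ k g C (P - r • v - r ^ m • w) u)) (Icc 0 b))
        (fun r => (j * (r ^ (j - 1) * ((-1 : ℝ) ^ k *
          iteratedFDerivWithin ℝ k g C (P - r • v - r ^ m • w) u)) +
          r ^ j * ((-1 : ℝ) ^ (k + 1) * iteratedFDerivWithin ℝ (k + 1) g C
            (P - r • v - r ^ m • w) (Fin.cons v u : Fin (k + 1) → E))) +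
          m * (r ^ (j + (m - 1)) * ((-1 : ℝ) ^ (k + 1) * iteratedFDerivWithin ℝ (k + 1) g C
            (P - r • v - r ^ m • w) (Fin.cons w u : Fin (k + 1) → E)))) (Icc 0 b) := by
      intro r hr
      have h := (hasDerivAt_pow j r).mul (hasDerivAt_signed_iteratedFDerivWithin_comp hC hg.1
        P v w m k u (hP r hr))
      refine (h.hasDerivWithinAt.derivWithin (huniq r hr)).trans ?_
      simp only [pow_add]
      ring
    have hcast : ((N : ℕ∞) : WithTop ℕ∞) ≤ ∞ := by exact_mod_cast le_top
    have hs : ∀ (c : ℝ) (j k : ℕ) (u : Fin k → E), ContDiffWithinAt ℝ N (fun r : ℝ => c * (r ^ j *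
        ((-1 : ℝ) ^ k * iteratedFDerivWithin ℝ k g C (P - r • v - r ^ m • w) u))) (Icc 0 b) r :=
      fun c j k u => contDiffWithinAt_const.mul ((hsm j k u).of_le hcast r hr)
    have hs' : ∀ (j k : ℕ) (u : Fin k → E), ContDiffWithinAt ℝ N (fun r : ℝ => (r ^ j *
        ((-1 : ℝ) ^ k * iteratedFDerivWithin ℝ k g C (P - r • v - r ^ m • w) u))) (Icc 0 b) r :=
      fun j k u => ((hsm j k u).of_le hcast r hr)
    have hcons : ∀ z ∈ C, ∀ i, (Fin.cons z u : Fin (k + 1) → E) i ∈ C := by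
      intro z hz i
      refine Fin.cases ?_ (fun i => ?_) i
      · simpa using hz
      · simpa using hu i
    rw [iteratedDerivWithin_congr hderiv hr,
      iteratedDerivWithin_fun_add hr huniq ((hs _ _ _ _).add (hs' _ _ _)) (hs _ _ _ _),
      iteratedDerivWithin_fun_add hr huniq (hs _ _ _ _) (hs' _ _ _),
      iteratedDerivWithin_const_mul_field, iteratedDerivWithin_const_mul_field]
    exact add_nonneg (add_nonneg (mul_nonneg j.cast_nonneg (ih _ _ _ hu r hr))
      (ih _ _ _ (hcons v hv) r hr)) (mul_nonneg m.cast_nonneg (ih _ _ _ (hcons w hw) r hr))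

theorem AbsolutelyMonotoneOn.of_completelyMonotoneOn_comp {g : E → ℝ} {C : Set E} (hC : IsOpen C)
    (hg : CompletelyMonotoneOn g C) {P v w : E} (hv : v ∈ C) (hw : w ∈ C) (m : ℕ) {b : ℝ}
    (hb : 0 < b) (hP : ∀ r ∈ Icc 0 b, P - r • v - r ^ m • w ∈ C) :
    AbsolutelyMonotoneOn (fun r : ℝ => g (P - r • v - r ^ m • w)) (Icc 0 b) := by
  rw [AbsolutelyMonotoneOn.iff_iteratedDerivWithin_nonneg (uniqueDiffOn_Icc hb)]
  refine ⟨hg.1.comp (ContDiff.contDiffOn (by fun_prop)) hP, fun N r hr => ?_⟩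
  simpa using iteratedDerivWithin_pow_mul_comp_nonneg hC hg hv hw m hb hP N 0 0 Fin.elim0
    (fun i => i.elim0) r hr

/-- The Taylor coefficients of an absolutely monotone function obey Cauchy-type estimates. -/
theorem AbsolutelyMonotoneOn.iteratedDerivWithin_div_factorial_mul_pow_le {h : ℝ → ℝ} {b : ℝ}
    (hb : 0 < b) (hh : AbsolutelyMonotoneOn h (Icc 0 b)) (N : ℕ) :
    iteratedDerivWithin N h (Icc 0 b) 0 / N ! * b ^ N ≤ h b := by
  have huniq : UniqueDiffOn ℝ (Icc 0 b) := uniqueDiffOn_Icc hb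
  obtain ⟨x, hx, hxe⟩ := taylor_mean_remainder_lagrange (f := h) (n := N) hb.ne
    (by rw [uIcc_of_le hb.le]; exact hh.contDiffOn.of_le (by exact_mod_cast le_top))
    (by
      rw [uIcc_of_le hb.le, uIoo_of_le hb.le]
      exact (hh.contDiffOn.differentiableOn_iteratedDerivWithin
        (mod_cast WithTop.coe_lt_coe.2 (ENat.natCast_lt_top N)) huniq).mono Ioo_subset_Icc_self)
  rw [uIcc_of_le hb.le] at hxe
  rw [uIoo_of_le hb.le] at hx
  have hrem : taylorWithinEval h N (Icc 0 b) 0 b ≤ h b := by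
    rw [← sub_nonneg, hxe]
    have := hh.iteratedDerivWithin_nonneg huniq (N + 1) (Ioo_subset_Icc_self hx)
    rw [sub_zero]
    positivity
  refine le_trans ?_ hrem
  rw [taylor_within_apply]
  have hnn : ∀ k ∈ Finset.range (N + 1),
      0 ≤ ((k ! : ℝ)⁻¹ * (b - 0) ^ k) • iteratedDerivWithin k h (Icc 0 b) 0 := by
    intro k _
    have := hh.iteratedDerivWithin_nonneg huniq k (left_mem_Icc.2 hb.le)
    rw [sub_zero, smul_eq_mul]
    positivity
  refine le_trans (le_of_eq ?_) (Finset.single_le_sum hnn (Finset.self_mem_range_succ N))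
  rw [sub_zero, smul_eq_mul]
  ring

end AbsoluteMonotonicity

theorem AnalyticAt.exists_eventually_sub_mul_deriv_eq {f : ℂ → ℂ} {c : ℂ} (hf : AnalyticAt ℂ f c)
    (hne : ¬ ∀ᶠ z in 𝓝 c, f z = 0) :
    ∃ (n : ℕ) (g : ℂ → ℂ), AnalyticAt ℂ g c ∧ g c ≠ 0 ∧ (∀ᶠ z in 𝓝 c, f z = (z - c) ^ n * g z) ∧
      ∀ᶠ z in 𝓝 c, (z - c) * deriv f z = (z - c) ^ n * (n * g z + (z - c) * deriv g z) := by
  obtain ⟨n, g, hg, hg0, hfg⟩ := hf.exists_eventuallyEq_pow_smul_nonzero_iff.2 hne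
  refine ⟨n, g, hg, hg0, by simpa using hfg, ?_⟩
  filter_upwards [hfg.eventually_nhds, hg.eventually_analyticAt] with z hz hgz
  have h : HasDerivAt (fun z => (z - c) ^ n • g z) _ z :=
    (((hasDerivAt_id z).sub_const c).pow n).mul hgz.differentiableAt.hasDerivAt
  have h' : deriv f z = _ := (h.congr_of_eventuallyEq hz).deriv
  rw [h']
  rcases n with _ | n
  · simp
  · simp
    ring

/-- If `G` solves the differential equation of a power `Φ ^ (-β)` with `0 < β` and is analytic
at `c`, then `Φ` does not vanish at `c`: a zero of `Φ` would force a pole or a branch point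
of `G`. -/
theorem AnalyticAt.ne_zero_of_deriv_mul_eq {Φ G : ℂ → ℂ} {c : ℂ} {β : ℝ} (hβ : 0 < β)
    (hΦ : AnalyticAt ℂ Φ c) (hG : AnalyticAt ℂ G c)
    (hode : ∀ᶠ z in 𝓝 c, deriv G z * Φ z = -β * (G z * deriv Φ z))
    (hΦ0 : ¬ ∀ᶠ z in 𝓝 c, Φ z = 0) (hG0 : ¬ ∀ᶠ z in 𝓝 c, G z = 0) : Φ c ≠ 0 := by
  obtain ⟨m, f, hf, hfc, hΦf, hΦd⟩ := hΦ.exists_eventually_sub_mul_deriv_eq hΦ0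
  obtain ⟨n, γ, hγ, hγc, hGγ, hGd⟩ := hG.exists_eventually_sub_mul_deriv_eq hG0
  set B : ℂ → ℂ := fun z => (n * γ z + (z - c) * deriv γ z) * f z +
    β * (γ z * (m * f z + (z - c) * deriv f z)) with hB
  have hBc : ContinuousAt B c := by
    have h1 := hf.continuousAt
    have h2 := hγ.continuousAt
    have h3 := hf.deriv.continuousAt
    have h4 := hγ.deriv.continuousAt
    fun_prop
  have hB0 : ∀ᶠ z in 𝓝[≠] c, B z = 0 := by
    have : ∀ᶠ z in 𝓝 c, z ≠ c → B z = 0 := by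
      filter_upwards [hode, hΦf, hΦd, hGγ, hGd] with z h1 h2 h3 h4 h5 hz
      have hz' : (z - c) ^ (n + m) ≠ 0 := pow_ne_zero _ (sub_ne_zero.2 hz)
      refine (mul_eq_zero.1 ?_).resolve_left hz'
      have e : (z - c) * deriv G z * Φ z + β * (G z * ((z - c) * deriv Φ z)) = 0 := by
        linear_combination (z - c) * h1
      rw [h3, h5, h2, h4] at e
      rw [← e, hB]
      ring
    exact eventually_nhdsWithin_iff.2 this
  have hBz : B c = 0 := by
    refine tendsto_nhds_unique (l := 𝓝[≠] c) (hBc.tendsto.mono_left nhdsWithin_le_nhds) ?_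
    exact tendsto_const_nhds.congr' (hB0.mono fun z hz => hz.symm)
  have hsum : ((n + β * m : ℝ) : ℂ) * (γ c * f c) = 0 := by
    rw [← hBz, hB]
    push_cast
    ring
  have hnm : (n + β * m : ℝ) = 0 := by
    exact_mod_cast (mul_eq_zero.1 hsum).resolve_right (mul_ne_zero hγc hfc)
  have hm : m = 0 := by
    by_contra hm
    have : (0 : ℝ) < m := by exact_mod_cast Nat.pos_of_ne_zero hm
    have := mul_pos hβ this
    have : (0 : ℝ) ≤ n := n.cast_nonneg
    linarith
  rw [hΦf.self_of_nhds, hm]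
  simpa using hfc

/-- A real analytic germ whose Taylor coefficients satisfy Cauchy estimates for the radius `b`
extends to a holomorphic function on the complex disc of radius `b`. -/
theorem AnalyticAt.exists_analyticOnNhd_ball_of_coeff_le {h : ℝ → ℝ} (hh : AnalyticAt ℝ h 0)
    {b M : ℝ} (hb : 0 < b) (hM : ∀ n, |iteratedDeriv n h 0 / n !| * b ^ n ≤ M) :
    ∃ G : ℂ → ℂ, AnalyticOnNhd ℂ G (Metric.ball 0 b) ∧ ∀ᶠ r : ℝ in 𝓝 0, G r = h r := by
  set p := FormalMultilinearSeries.ofScalars ℂ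
    (fun n => ((iteratedDeriv n h 0 / n ! : ℝ) : ℂ)) with hp
  lift b to NNReal using hb.le
  have hrad : (b : ENNReal) ≤ p.radius := by
    refine p.le_radius_of_bound M fun n => ?_
    rw [hp, FormalMultilinearSeries.ofScalars_norm, Complex.norm_real, Real.norm_eq_abs]
    exact hM n
  have hb' : 0 < (b : ENNReal) := by exact_mod_cast hb
  have hps := p.hasFPowerSeriesOnBall (hb'.trans_le hrad)
  have hball : Metric.ball (0 : ℂ) b = Metric.eball 0 b := by
    rw [Metric.eball_coe]
  refine ⟨p.sum,
    fun z hz => hps.analyticAt_of_mem (Metric.eball_subset_eball hrad (hball ▸ hz)), ?_⟩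
  have hev : ∀ᶠ r : ℝ in 𝓝 0, (r : ℂ) ∈ Metric.ball (0 : ℂ) b :=
    Complex.continuous_ofReal.continuousAt.eventually_mem
      (by simpa using Metric.ball_mem_nhds (0 : ℂ) hb)
  filter_upwards [hh.hasFPowerSeriesAt.eventually_hasSum, hev] with r hr hrb
  have h1 := hps.hasSum (Metric.eball_subset_eball hrad (hball ▸ hrb))
  rw [zero_add] at h1 hr
  simp only [FormalMultilinearSeries.ofScalars_apply_eq, hp] at h1 hr
  refine h1.unique ?_
  simpa using Complex.hasSum_ofReal.2 hr

/-- If the negative power `Φ ^ (-β)` is absolutely monotone on `[0, b]`, then `Φ` has no zeros in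
the complex disc of radius `b`. -/
theorem AnalyticOnNhd.ne_zero_of_absolutelyMonotoneOn_rpow {Φ : ℂ → ℂ} {b β : ℝ} (hb : 0 < b)
    (hβ : 0 < β) (hΦ : AnalyticOnNhd ℂ Φ (Metric.ball 0 b))
    (hreal : ∀ᶠ r : ℝ in 𝓝 0, (Φ r).im = 0 ∧ 0 < (Φ r).re)
    (habs : AbsolutelyMonotoneOn (fun r : ℝ => (Φ r).re ^ (-β)) (Icc 0 b)) :
    ∀ z ∈ Metric.ball (0 : ℂ) b, Φ z ≠ 0 := by
  have h0 : (0 : ℂ) ∈ Metric.ball (0 : ℂ) b := Metric.mem_ball_self hb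
  have hpre : IsPreconnected (Metric.ball (0 : ℂ) b) := (convex_ball 0 b).isPreconnected
  have hΦre0 : 0 < (Φ 0).re := by simpa using hreal.self_of_nhds.2
  have hΦ00 : Φ 0 ≠ 0 := fun h => by simp [h] at hΦre0
  have hH : AnalyticAt ℝ (fun r : ℝ => (Φ r).re ^ (-β)) 0 := by
    have h1 : AnalyticAt ℝ (fun r : ℝ => (Φ r).re) 0 :=
      AnalyticAt.re_ofReal (by simpa using hΦ 0 h0)
    exact AnalyticAt.fun_comp (g := fun y : ℝ => y ^ (-β))
      (Real.contDiffAt_rpow_const_of_ne (n := ω) (by simpa using hΦre0.ne')).analyticAt h1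
  have h0mem : (0 : ℝ) ∈ Icc 0 b := left_mem_Icc.2 hb.le
  have hcoef : ∀ n, |iteratedDeriv n (fun r : ℝ => (Φ r).re ^ (-β)) 0 / n !| * b ^ n ≤
      (Φ b).re ^ (-β) := by
    intro n
    rw [← iteratedDerivWithin_eq_iteratedDeriv (uniqueDiffOn_Icc hb) hH.contDiffAt h0mem,
      abs_of_nonneg (div_nonneg (habs.iteratedDerivWithin_nonneg (uniqueDiffOn_Icc hb) n h0mem)
        (Nat.cast_nonneg _))]
    exact habs.iteratedDerivWithin_div_factorial_mul_pow_le hb n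
  obtain ⟨G, hG, hGr⟩ := hH.exists_analyticOnNhd_ball_of_coeff_le hb hcoef
  have hslit : Φ 0 ∈ Complex.slitPlane := Or.inl hΦre0
  have hK : AnalyticAt ℂ (fun z => Φ z ^ (-β : ℂ)) 0 :=
    (hΦ 0 h0).cpow analyticAt_const hslit
  have hGK : ∀ᶠ z in 𝓝 (0 : ℂ), G z = Φ z ^ (-β : ℂ) := by
    rw [← (hG 0 h0).frequently_eq_iff_eventually_eq hK]
    have hev : ∀ᶠ r : ℝ in 𝓝[≠] 0, G r = Φ r ^ (-β : ℂ) := by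
      filter_upwards [nhdsWithin_le_nhds hGr, nhdsWithin_le_nhds hreal] with r hr hr'
      have : Φ r = ((Φ r).re : ℂ) := Complex.ext rfl (by simpa using hr'.1)
      rw [hr, Complex.ofReal_cpow hr'.2.le, ← this]
      simp
    have ht : Tendsto (fun r : ℝ => (r : ℂ)) (𝓝[≠] 0) (𝓝[≠] 0) := by
      refine tendsto_nhdsWithin_of_tendsto_nhds_of_eventually_within _ ?_ ?_
      · exact (Complex.continuous_ofReal.tendsto' 0 0 (by simp)).mono_left nhdsWithin_le_nhds
      · filter_upwards [self_mem_nhdsWithin] with r hr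
        simpa using hr
    exact ht.frequently hev.frequently
  have hode : EqOn (fun z => deriv G z * Φ z) (fun z => -β * (G z * deriv Φ z))
      (Metric.ball 0 b) := by
    refine AnalyticOnNhd.eqOn_of_preconnected_of_eventuallyEq (hG.deriv.mul hΦ)
      (analyticOnNhd_const.mul (hG.mul hΦ.deriv)) hpre h0 ?_
    filter_upwards [hGK.eventually_nhds, (hΦ 0 h0).eventually_analyticAt,
      (hΦ 0 h0).continuousAt.eventually_mem (Complex.isOpen_slitPlane.mem_nhds hslit)]
      with z hz hΦz hzs
    have hd := (hΦz.differentiableAt.hasDerivAt.cpow_const (c := (-β : ℂ))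
      hzs).congr_of_eventuallyEq hz
    have hΦz0 : Φ z ≠ 0 := Complex.slitPlane_ne_zero hzs
    rw [hd.deriv, hz.self_of_nhds, Complex.cpow_sub _ _ hΦz0, Complex.cpow_one]
    field_simp
  have hnot : ∀ {f : ℂ → ℂ}, AnalyticOnNhd ℂ f (Metric.ball 0 b) → f 0 ≠ 0 →
      ∀ z ∈ Metric.ball (0 : ℂ) b, ¬ ∀ᶠ w in 𝓝 z, f w = 0 := fun hf hf0 z hz hev =>
    hf0 (hf.eqOn_zero_of_preconnected_of_eventuallyEq_zero hpre hz hev h0)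
  have hG0 : G 0 ≠ 0 := by
    rw [hGK.self_of_nhds]
    exact fun h => hΦ00 (Complex.cpow_eq_zero_iff _ _ |>.1 h).1
  intro z hz
  exact (hΦ z hz).ne_zero_of_deriv_mul_eq hβ (hG z hz)
    (hode.eventuallyEq_of_mem (Metric.isOpen_ball.mem_nhds hz)) (hnot hΦ hΦ00 z hz)
    (hnot hG hG0 z hz)

section Cone

variable {E : Type*} [AddCommGroup E] [Module ℝ E] {C : Set E}

theorem Convex.add_smul_mem_of_cone (hconv : Convex ℝ C)
    (hcone : ∀ x ∈ C, ∀ t : ℝ, 0 < t → t • x ∈ C) {x v : E} (hx : x ∈ C) (hv : v ∈ C)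
    {s : ℝ} (hs : 0 ≤ s) : x + s • v ∈ C := by
  rcases hs.eq_or_lt with rfl | hs
  · simpa using hx
  have h := hconv hx (hcone v hv s hs) (a := 1 / 2) (b := 1 / 2) (by norm_num) (by norm_num)
    (by norm_num)
  have h2 := hcone _ h 2 two_pos
  rwa [smul_add, smul_smul, smul_smul, mul_one_div_cancel two_ne_zero, one_smul, one_smul] at h2

variable [TopologicalSpace E] [IsTopologicalAddGroup E] [ContinuousSMul ℝ E]

/-- Every vector is a difference of two elements of an open cone. -/
theorem IsOpen.exists_sub_eq_of_cone (hopen : IsOpen C)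
    (hcone : ∀ x ∈ C, ∀ t : ℝ, 0 < t → t • x ∈ C) {x : E} (hx : x ∈ C) (y : E) :
    ∃ a ∈ C, ∃ b ∈ C, a - b = y := by
  have ht : Tendsto (fun s : ℝ => x + s • y) (𝓝[>] 0) (𝓝 x) := by
    have : Continuous fun s : ℝ => x + s • y := by fun_prop
    exact (this.tendsto' 0 x (by simp)).mono_left nhdsWithin_le_nhds
  obtain ⟨s, hs, hs0⟩ := ((ht.eventually (hopen.mem_nhds hx)).and self_mem_nhdsWithin).exists
  have hs0 : 0 < s := hs0
  refine ⟨s⁻¹ • (x + s • y), hcone _ hs _ (inv_pos.2 hs0), s⁻¹ • x,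
    hcone _ hx _ (inv_pos.2 hs0), ?_⟩
  rw [smul_add, smul_smul, inv_mul_cancel₀ hs0.ne', one_smul, add_sub_cancel_left]

/-- A root of unity in the upper half plane, so close to `1` that moving from `x` against `c` by
the tangent of half its argument does not leave the open set `C`. -/
theorem IsOpen.exists_pow_eq_conj_and_sub_smul_mem (hopen : IsOpen C) {x : E} (hx : x ∈ C)
    (c : E) :
    ∃ (m : ℕ) (w : ℂ), ‖w‖ = 1 ∧ w ^ m = (starRingEnd ℂ) w ∧ 0 < w.im ∧
      x - ((1 - w.re) / w.im) • c ∈ C := by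
  have hlim : Tendsto (fun n : ℕ => Real.pi / ((n : ℝ) + 3)) atTop (𝓝 0) :=
    tendsto_const_nhds.div_atTop (tendsto_atTop_add_const_right _ _ tendsto_natCast_atTop_atTop)
  have ht : Tendsto (fun n : ℕ => x - Real.tan (Real.pi / ((n : ℝ) + 3)) • c) atTop (𝓝 x) := by
    have htan : Tendsto Real.tan (𝓝 0) (𝓝 0) := by
      simpa using (Real.continuousAt_tan.2 (by simp : Real.cos 0 ≠ 0)).tendsto
    simpa using tendsto_const_nhds.sub ((htan.comp hlim).smul_const c)
  obtain ⟨n, hn : x - Real.tan (Real.pi / ((n : ℝ) + 3)) • c ∈ C⟩ :=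
    (ht.eventually (hopen.mem_nhds hx)).exists
  set ψ : ℝ := Real.pi / ((n : ℝ) + 3) with hψ
  have hn3 : (0 : ℝ) < (n : ℝ) + 3 := by positivity
  have hψ0 : 0 < ψ := div_pos Real.pi_pos hn3
  have hψ1 : ψ < Real.pi / 2 :=
    div_lt_div_of_pos_left Real.pi_pos two_pos (by linarith [n.cast_nonneg (α := ℝ)])
  have hsin : 0 < Real.sin ψ := Real.sin_pos_of_pos_of_lt_pi hψ0 (by linarith)
  have hcos : 0 < Real.cos ψ := Real.cos_pos_of_mem_Ioo ⟨by linarith, hψ1⟩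
  set w : ℂ := Complex.exp ((2 * ψ : ℝ) * Complex.I) with hw
  have hre : w.re = Real.cos (2 * ψ) := Complex.exp_ofReal_mul_I_re _
  have him : w.im = Real.sin (2 * ψ) := Complex.exp_ofReal_mul_I_im _
  have hnorm : ‖w‖ = 1 := Complex.norm_exp_ofReal_mul_I _
  have hw0 : w ≠ 0 := Complex.exp_ne_zero _
  refine ⟨n + 2, w, hnorm, ?_, ?_, ?_⟩
  · refine mul_right_cancel₀ hw0 ?_
    rw [← pow_succ, ← Complex.normSq_eq_conj_mul_self, Complex.normSq_eq_norm_sq, hnorm, hw,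
      ← Complex.exp_nat_mul]
    convert Complex.exp_two_pi_mul_I using 2
    · rw [hψ]
      have : ((n : ℂ) + 3) ≠ 0 := by exact_mod_cast hn3.ne'
      push_cast
      field_simp
      ring
    · simp
  · rw [him]
    exact Real.sin_pos_of_pos_of_lt_pi (by linarith) (by linarith)
  · suffices h : (1 - w.re) / w.im = Real.tan ψ by rwa [h]
    rw [hre, him, Real.tan_eq_sin_div_cos, Real.sin_two_mul, Real.cos_two_mul,
      div_eq_div_iff (by positivity) hcos.ne']
    nlinarith [Real.sin_sq_add_cos_sq ψ, mul_pos hsin hcos]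

theorem Convex.exists_one_lt_forall_curve_mem (hopen : IsOpen C) (hconv : Convex ℝ C)
    (hcone : ∀ x ∈ C, ∀ t : ℝ, 0 < t → t • x ∈ C) {P v u : E} (hv : v ∈ C) (hu : u ∈ C) (m : ℕ)
    (h1 : P - v - u ∈ C) :
    ∃ b : ℝ, 1 < b ∧ ∀ r ∈ Icc 0 b, P - r • v - r ^ m • u ∈ C := by
  have hc : Continuous fun r : ℝ => P - r • v - r ^ m • u := by fun_prop
  have hmem : ∀ᶠ r in 𝓝 (1 : ℝ), P - r • v - r ^ m • u ∈ C :=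
    hc.continuousAt.eventually_mem (hopen.mem_nhds (by simpa using h1))
  obtain ⟨l, c, ⟨hl, hc1⟩, hlc⟩ := mem_nhds_iff_exists_Ioo_subset.1 hmem
  refine ⟨(1 + c) / 2, by linarith, fun r hr => ?_⟩
  rcases le_or_gt r 1 with hr1 | hr1
  · have h2 := hconv.add_smul_mem_of_cone hcone
      (hconv.add_smul_mem_of_cone hcone h1 hv (sub_nonneg.2 hr1)) hu
      (sub_nonneg.2 (pow_le_one₀ hr.1 hr1 (n := m)))
    convert h2 using 1
    module
  · exact hlc ⟨hl.trans hr1, hr.2.trans_lt (by linarith)⟩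

end Cone

theorem curve_mem_tube {n : ℕ} {C : Set (Fin n → ℝ)} (hconv : Convex ℝ C)
    (hcone : ∀ x ∈ C, ∀ t : ℝ, 0 < t → t • x ∈ C) {P v u : Fin n → ℝ} (hv : v ∈ C) (hu : u ∈ C)
    {m : ℕ} {w : ℂ} (hw : P - ‖w‖ • v - ‖w‖ ^ m • u ∈ C) :
    (fun i => (P i : ℂ) - w * v i - w ^ m * u i) ∈ tube C := by
  have h := hconv.add_smul_mem_of_cone hcone (hconv.add_smul_mem_of_cone hcone hw hv
    (sub_nonneg.2 (Complex.re_le_norm w))) hu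
    (sub_nonneg.2 ((Complex.re_le_norm (w ^ m)).trans_eq (norm_pow w m)))
  rw [tube, mem_ofPred_eq]
  convert h using 1
  ext i
  simp only [Complex.sub_re, Complex.ofReal_re, Complex.re_mul_ofReal, Pi.add_apply, Pi.sub_apply,
    Pi.smul_apply, smul_eq_mul]
  ring

/-- Let `C` be a nonempty open convex cone in `ℝ^n` and `F` analytic on
the tube `C + iℝ^n`, real and strictly positive on `C`.  If `F^{-β}` is completely
monotone on `C` for some `β > 0`, then `F` is nonvanishing on the tube. -/
theorem nonvanishing_of_completely_monotone_inverse_power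
    {n : ℕ} (C : Set (Fin n → ℝ))
    (hne : C.Nonempty) (hopen : IsOpen C) (hconv : Convex ℝ C)
    (hcone : ∀ x ∈ C, ∀ t : ℝ, 0 < t → t • x ∈ C)
    (F : (Fin n → ℂ) → ℂ)
    (hF : AnalyticOnNhd ℂ F (tube C))
    (hreal : ∀ x ∈ C, (F (fun i => (x i : ℂ))).im = 0)
    (hpos : ∀ x ∈ C, 0 < (F (fun i => (x i : ℂ))).re)
    (hCM : ∃ β : ℝ, 0 < β ∧
      CompletelyMonotoneOn (fun x : Fin n → ℝ => (F (fun i => (x i : ℂ))).re ^ (-β)) C) :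
    ∀ z ∈ tube C, F z ≠ 0 := by
  obtain ⟨β, hβ, hg⟩ := hCM
  intro z hz
  set x : Fin n → ℝ := fun i => (z i).re with hx
  have hxC : x ∈ C := hz
  obtain ⟨a, ha, b, hb, hab⟩ := hopen.exists_sub_eq_of_cone hcone hxC (fun i => (z i).im)
  obtain ⟨m, w, hw1, hwm, hwim, hwC⟩ := hopen.exists_pow_eq_conj_and_sub_smul_mem hxC (a + b)
  set v : Fin n → ℝ := w.im⁻¹ • b with hv
  set u : Fin n → ℝ := w.im⁻¹ • a with hu
  set P : Fin n → ℝ := x + w.re • (v + u) with hP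
  have hvC : v ∈ C := hcone b hb _ (inv_pos.2 hwim)
  have huC : u ∈ C := hcone a ha _ (inv_pos.2 hwim)
  have hend : P - v - u ∈ C := by
    convert hwC using 1
    rw [hP, hv, hu, div_eq_mul_inv]
    module
  obtain ⟨R, hR, hRC⟩ := hconv.exists_one_lt_forall_curve_mem hopen hcone hvC huC m hend
  have hR0 : 0 < R := one_pos.trans hR
  set Φ : ℂ → ℂ := fun w => F (fun i => (P i : ℂ) - w * v i - w ^ m * u i) with hΦ
  have hΦr : ∀ r : ℝ, Φ r = F (fun i => ((P - r • v - r ^ m • u) i : ℂ)) := by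
    intro r
    simp [hΦ]
  have han : AnalyticOnNhd ℂ Φ (Metric.ball 0 R) := by
    refine DifferentiableOn.analyticOnNhd (fun ζ hζ => ?_) Metric.isOpen_ball
    have hmem := curve_mem_tube hconv hcone hvC huC (m := m) (w := ζ)
      (hRC _ ⟨norm_nonneg ζ, (mem_ball_zero_iff.1 hζ).le⟩)
    have hp : DifferentiableAt ℂ (fun (w : ℂ) i => (P i : ℂ) - w * v i - w ^ m * u i) ζ := by
      fun_prop
    exact ((hF _ hmem).differentiableAt.comp ζ hp).differentiableWithinAt
  have hreal0 : ∀ᶠ r : ℝ in 𝓝 0, (Φ r).im = 0 ∧ 0 < (Φ r).re := by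
    have hc : Continuous fun r : ℝ => P - r • v - r ^ m • u := by fun_prop
    filter_upwards [hc.continuousAt.eventually_mem
      (hopen.mem_nhds (hRC 0 (left_mem_Icc.2 hR0.le)))] with r hr
    rw [hΦr]
    exact ⟨hreal _ hr, hpos _ hr⟩
  have habs : AbsolutelyMonotoneOn (fun r : ℝ => (Φ r).re ^ (-β)) (Icc 0 R) := by
    simp only [hΦr]
    exact AbsolutelyMonotoneOn.of_completelyMonotoneOn_comp hopen hg hvC huC m hR0 hRC
  have hne := han.ne_zero_of_absolutelyMonotoneOn_rpow hR0 hβ hreal0 habs w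
    (by rwa [mem_ball_zero_iff, hw1])
  convert hne using 2
  ext i
  have hi : a i - b i = (z i).im := congrFun hab i
  apply Complex.ext
  · simp [hwm, hP, hx]
    ring
  · simp [hwm, hv, hu, ← hi]
    field_simp
    ring
end

section
/- Let C be an open convex cone in a finite-dimensional real vector space V, fix β > 0, and let A, B : C → (0,∞). Then the following are equivalent: (a) the function (x,y) ↦ (A(x) + B(x)y)^{-β} is completely monotone on C × (0,∞); (b) for every t ≥ 0, the function x ↦ B(x)^{-β} exp(−t A(x)/B(x)) is completely monotone on C; (c) for every real κ ≥ −β and every z ≥ 0, the function x ↦ B(x)^{κ} (A(x) + zB(x))^{-(β+κ)} is completely monotone on C; (d) for every integer k ≥ 0 and every z ≥ 0, the function x ↦ B(x)^{k} (A(x) + zB(x))^{-(β+k)} is completely monotone on C. -/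
open Set Filter Topology MeasureTheory

section FiniteDifferences

variable {E : Type*} [AddCommGroup E]

/-- The iterated alternating finite difference of `f` along a list of directions: each
direction `u` replaces `f` by `x ↦ f x - f (x + u)`. -/
def altDiff : List E → (E → ℝ) → E → ℝ
  | [], f => f
  | u :: l, f => altDiff l (fun x => f x - f (x + u))

/-- All alternating finite differences of `f` along directions in `C` are nonnegative on `C`. -/
def AltDiffNonneg (C : Set E) (f : E → ℝ) : Prop :=
  ∀ l : List E, (∀ u ∈ l, u ∈ C) → ∀ x ∈ C, 0 ≤ altDiff l f x

variable {C : Set E}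

lemma altDiff_congr (hadd : ∀ x ∈ C, ∀ u ∈ C, x + u ∈ C) {l : List E}
    (hl : ∀ u ∈ l, u ∈ C) {f g : E → ℝ} (hfg : EqOn f g C) {x : E} (hx : x ∈ C) :
    altDiff l f x = altDiff l g x := by
  induction l generalizing f g with
  | nil => exact hfg hx
  | cons u l ih =>
    rw [List.forall_mem_cons] at hl
    exact ih hl.2 fun y hy => by simp only [hfg hy, hfg (hadd y hy u hl.1)]

lemma altDiff_add (l : List E) (f g : E → ℝ) (x : E) :
    altDiff l (fun y => f y + g y) x = altDiff l f x + altDiff l g x := by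
  induction l generalizing f g with
  | nil => rfl
  | cons u l ih =>
    simp only [altDiff, ← ih]
    congr 1
    ext y
    ring

lemma altDiff_const_mul (l : List E) (c : ℝ) (f : E → ℝ) (x : E) :
    altDiff l (fun y => c * f y) x = c * altDiff l f x := by
  induction l generalizing f with
  | nil => rfl
  | cons u l ih => simp only [altDiff, ← ih, mul_sub]

lemma tendsto_altDiff {ι : Type*} {F : Filter ι} (hadd : ∀ x ∈ C, ∀ u ∈ C, x + u ∈ C)
    {l : List E} (hl : ∀ u ∈ l, u ∈ C) {f : ι → E → ℝ} {g : E → ℝ}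
    (hfg : ∀ x ∈ C, Tendsto (fun i => f i x) F (𝓝 (g x))) {x : E} (hx : x ∈ C) :
    Tendsto (fun i => altDiff l (f i) x) F (𝓝 (altDiff l g x)) := by
  induction l generalizing f g with
  | nil => exact hfg x hx
  | cons u l ih =>
    rw [List.forall_mem_cons] at hl
    exact ih hl.2 fun y hy => (hfg y hy).sub (hfg _ (hadd y hy u hl.1))

lemma altDiff_integral {T : Type*} [MeasurableSpace T] {μ : Measure T}
    (hadd : ∀ x ∈ C, ∀ u ∈ C, x + u ∈ C) {l : List E} (hl : ∀ u ∈ l, u ∈ C)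
    {f : T → E → ℝ} (hf : ∀ x ∈ C, Integrable (fun t => f t x) μ) {x : E} (hx : x ∈ C) :
    altDiff l (fun y => ∫ t, f t y ∂μ) x = ∫ t, altDiff l (f t) x ∂μ := by
  induction l generalizing f with
  | nil => rfl
  | cons u l ih =>
    rw [List.forall_mem_cons] at hl
    have hu : ∀ y ∈ C, Integrable (fun t => f t (y + u)) μ := fun y hy => hf _ (hadd y hy u hl.1)
    simp only [altDiff]
    rw [← ih (f := fun t y => f t y - f t (y + u)) hl.2 fun y hy => (hf y hy).sub (hu y hy)]
    exact altDiff_congr hadd hl.2 (fun y hy => (integral_sub (hf y hy) (hu y hy)).symm) hx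

namespace AltDiffNonneg

variable {f g : E → ℝ}

lemma nonneg (hf : AltDiffNonneg C f) {x : E} (hx : x ∈ C) : 0 ≤ f x :=
  hf [] (by simp) x hx

lemma sub_shift (hf : AltDiffNonneg C f) {u : E} (hu : u ∈ C) :
    AltDiffNonneg C (fun x => f x - f (x + u)) := fun l hl x hx =>
  hf (u :: l) (List.forall_mem_cons.2 ⟨hu, hl⟩) x hx

lemma congr (hadd : ∀ x ∈ C, ∀ u ∈ C, x + u ∈ C) (hf : AltDiffNonneg C f) (h : EqOn f g C) :
    AltDiffNonneg C g := fun l hl x hx =>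
  (hf l hl x hx).trans_eq (altDiff_congr hadd hl h hx)

lemma add (hf : AltDiffNonneg C f) (hg : AltDiffNonneg C g) :
    AltDiffNonneg C (fun x => f x + g x) := fun l hl x hx => by
  rw [altDiff_add]
  exact add_nonneg (hf l hl x hx) (hg l hl x hx)

lemma const_mul (hf : AltDiffNonneg C f) {c : ℝ} (hc : 0 ≤ c) :
    AltDiffNonneg C (fun x => c * f x) := fun l hl x hx => by
  rw [altDiff_const_mul]
  exact mul_nonneg hc (hf l hl x hx)

lemma of_tendsto {ι : Type*} {F : Filter ι} [F.NeBot] (hadd : ∀ x ∈ C, ∀ u ∈ C, x + u ∈ C)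
    {f : ι → E → ℝ} (hf : ∀ᶠ i in F, AltDiffNonneg C (f i))
    (hfg : ∀ x ∈ C, Tendsto (fun i => f i x) F (𝓝 (g x))) : AltDiffNonneg C g :=
  fun l hl _ hx => ge_of_tendsto (tendsto_altDiff hadd hl hfg hx)
    (hf.mono fun _ h => h l hl _ hx)

lemma integral {T : Type*} [MeasurableSpace T] {μ : Measure T}
    (hadd : ∀ x ∈ C, ∀ u ∈ C, x + u ∈ C) {f : T → E → ℝ}
    (hf : ∀ᵐ t ∂μ, AltDiffNonneg C (f t)) (hint : ∀ x ∈ C, Integrable (fun t => f t x) μ) :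
    AltDiffNonneg C (fun x => ∫ t, f t x ∂μ) := fun l hl x hx => by
  rw [altDiff_integral hadd hl hint hx]
  exact integral_nonneg_of_ae (hf.mono fun t ht => ht l hl x hx)

/-- If the alternating differences of `f` in direction `c • w` are all admissible for `c > 0`,
then so is minus the line derivative of `f` in direction `w`. -/
lemma neg_lineDeriv [Module ℝ E] (hadd : ∀ x ∈ C, ∀ u ∈ C, x + u ∈ C) {w : E}
    (hf : ∀ c : ℝ, 0 < c → AltDiffNonneg C (fun x => f x - f (x + c • w)))
    (hd : ∀ x ∈ C, HasDerivAt (fun c : ℝ => f (x + c • w)) (g x) 0) :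
    AltDiffNonneg C (fun x => -g x) := by
  refine of_tendsto (F := 𝓝[>] (0 : ℝ)) (f := fun c x => c⁻¹ * (f x - f (x + c • w))) hadd ?_ ?_
  · filter_upwards [self_mem_nhdsWithin] with c hc
    exact (hf c hc).const_mul (inv_nonneg.2 (le_of_lt hc))
  · intro x hx
    convert! (hd x hx).tendsto_slope_zero_right.neg using 2
    simp only [zero_add, zero_smul, add_zero, smul_eq_mul]
    ring

/-- The product of `f` with a decaying exponential in a separate positive variable. -/
lemma mul_exp_neg (hf : AltDiffNonneg C f) {t : ℝ} (ht : 0 ≤ t) :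
    AltDiffNonneg (C ×ˢ Ioi (0 : ℝ)) (fun p => f p.1 * Real.exp (-(t * p.2))) := by
  intro l
  induction l generalizing f with
  | nil => exact fun _ p hp => mul_nonneg (hf.nonneg hp.1) (Real.exp_pos _).le
  | cons u l ih =>
    intro hl p hp
    rw [List.forall_mem_cons] at hl
    obtain ⟨⟨hu₁, hu₂⟩, hl⟩ := hl
    have hexp : Real.exp (-(t * u.2)) ≤ 1 :=
      Real.exp_le_one_iff.2 (neg_nonpos.2 (mul_nonneg ht (le_of_lt hu₂)))
    have hstep := ((hf.sub_shift hu₁).const_mul (Real.exp_pos (-(t * u.2))).le).add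
      (hf.const_mul (sub_nonneg.2 hexp))
    refine (ih hstep hl p hp).trans_eq (congrArg (altDiff l · p) (funext fun q => ?_))
    simp only [Prod.fst_add, Prod.snd_add, mul_add, neg_add, Real.exp_add]
    ring

end AltDiffNonneg

end FiniteDifferences

section CompletelyMonotone

variable {E : Type*} [NormedAddCommGroup E] [NormedSpace ℝ E] {C : Set E} {f : E → ℝ}

lemma CompletelyMonotoneOn.sub_shift (hopen : IsOpen C)
    (hadd : ∀ x ∈ C, ∀ u ∈ C, x + u ∈ C) (hcone : ∀ x ∈ C, ∀ t : ℝ, 0 < t → t • x ∈ C)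
    (hf : CompletelyMonotoneOn f C) {u : E} (hu : u ∈ C) :
    CompletelyMonotoneOn (fun x => f x - f (x + u)) C := by
  obtain ⟨hs, hn⟩ := hf
  have hshift : ContDiffOn ℝ (⊤ : ℕ∞) (fun x => f (x + u)) C :=
    hs.comp (by fun_prop) fun x hx => hadd x hx u hu
  refine ⟨hs.sub hshift, fun k v hv x hx => ?_⟩
  have hle : ((k : ℕ∞) : WithTop ℕ∞) ≤ ((⊤ : ℕ∞) : WithTop ℕ∞) := by exact_mod_cast le_top
  have hlt : ((k : ℕ∞) : WithTop ℕ∞) < ((⊤ : ℕ∞) : WithTop ℕ∞) := by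
    exact_mod_cast ENat.natCast_lt_top k
  have hseg : ∀ s ∈ Icc (0 : ℝ) 1, x + s • u ∈ C := by
    rintro s ⟨hs0, -⟩
    rcases hs0.eq_or_lt with rfl | hs0
    · simpa using hx
    · exact hadd x hx _ (hcone u hu s hs0)
  have hder : ∀ s ∈ Icc (0 : ℝ) 1, HasDerivAt
      (fun s : ℝ => (-1 : ℝ) ^ k * iteratedFDerivWithin ℝ k f C (x + s • u) v)
      (-((-1 : ℝ) ^ (k + 1) *
        iteratedFDerivWithin ℝ (k + 1) f C (x + s • u) (Fin.cons u v))) s := by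
    intro s hsI
    have hmem := hseg s hsI
    have h1 : HasFDerivAt (iteratedFDerivWithin ℝ k f C)
        (fderivWithin ℝ (iteratedFDerivWithin ℝ k f C) C (x + s • u)) (x + s • u) :=
      ((hs.differentiableOn_iteratedFDerivWithin hlt hopen.uniqueDiffOn) _
        hmem).hasFDerivWithinAt.hasFDerivAt (hopen.mem_nhds hmem)
    have h2 : HasDerivAt (fun s : ℝ => x + s • u) u s := by
      simpa using ((hasDerivAt_id s).smul_const u).const_add x
    have h3 := h1.comp_hasDerivAt s h2
    have h4 := ((ContinuousMultilinearMap.apply ℝ (fun _ : Fin k => E) ℝ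
      v).hasFDerivAt.comp_hasDerivAt s h3).const_mul ((-1 : ℝ) ^ k)
    convert! h4 using 1
    rw [iteratedFDerivWithin_succ_apply_left]
    simp [pow_succ]
  have hanti := antitoneOn_of_deriv_nonpos (convex_Icc (0 : ℝ) 1)
    (fun s hsI => (hder s hsI).continuousAt.continuousWithinAt)
    (fun s hsI => (hder s (interior_subset hsI)).differentiableAt.differentiableWithinAt)
    (fun s hsI => by
      rw [(hder s (interior_subset hsI)).deriv, neg_nonpos]
      refine hn _ _ (fun i => ?_) _ (hseg s (interior_subset hsI))
      exact Fin.cases hu hv i)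
  have h01 := hanti (left_mem_Icc.2 zero_le_one) (right_mem_Icc.2 zero_le_one) zero_le_one
  simp only [one_smul, zero_smul, add_zero] at h01
  rw [fun_iteratedFDerivWithin_sub_apply ((hs x hx).of_le hle) ((hshift x hx).of_le hle)
    hopen.uniqueDiffOn hx, iteratedFDerivWithin_of_isOpen (f := fun x => f (x + u)) k hopen hx,
    iteratedFDeriv_comp_add_right, ← iteratedFDerivWithin_of_isOpen k hopen (hadd x hx u hu),
    sub_apply, mul_sub]
  exact sub_nonneg.2 h01

lemma CompletelyMonotoneOn.altDiffNonneg (hopen : IsOpen C)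
    (hadd : ∀ x ∈ C, ∀ u ∈ C, x + u ∈ C) (hcone : ∀ x ∈ C, ∀ t : ℝ, 0 < t → t • x ∈ C)
    (hf : CompletelyMonotoneOn f C) : AltDiffNonneg C f := by
  intro l
  induction l generalizing f with
  | nil => exact fun _ x hx => by simpa [altDiff] using hf.2 0 0 (fun i => i.elim0) x hx
  | cons u l ih =>
    intro hl x hx
    rw [List.forall_mem_cons] at hl
    exact ih (hf.sub_shift hopen hadd hcone hl.1) hl.2 x hx

lemma AltDiffNonneg.completelyMonotoneOn (hopen : IsOpen C)
    (hadd : ∀ x ∈ C, ∀ u ∈ C, x + u ∈ C) (hcone : ∀ x ∈ C, ∀ t : ℝ, 0 < t → t • x ∈ C)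
    (hf : AltDiffNonneg C f) (hs : ContDiffOn ℝ (⊤ : ℕ∞) f C) : CompletelyMonotoneOn f C := by
  refine ⟨hs, fun k => ?_⟩
  induction k generalizing f with
  | zero => exact fun _ _ x hx => by simpa using hf.nonneg hx
  | succ k ih =>
    intro v hv x hx
    set w := v (Fin.last k)
    have hle : ((k : ℕ∞) : WithTop ℕ∞) ≤ ((⊤ : ℕ∞) : WithTop ℕ∞) := by exact_mod_cast le_top
    have hs' : ContDiffOn ℝ (⊤ : ℕ∞) (fderivWithin ℝ f C) C :=
      hs.fderivWithin hopen.uniqueDiffOn (by simp)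
    have hg : AltDiffNonneg C (fun y => -fderivWithin ℝ f C y w) := by
      refine neg_lineDeriv hadd (fun c hc => hf.sub_shift (hcone w (hv _) c hc)) fun y hy => ?_
      have h1 : HasFDerivAt f (fderivWithin ℝ f C y) y :=
        ((hs.differentiableOn (by simp)) y hy).hasFDerivWithinAt.hasFDerivAt (hopen.mem_nhds hy)
      exact h1.hasLineDerivAt w
    have hsg : ContDiffOn ℝ (⊤ : ℕ∞) (fun y => -fderivWithin ℝ f C y w) C :=
      (hs'.clm_apply contDiffOn_const).neg
    have key := ih hg hsg (Fin.init v) (fun i => hv _) x hx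
    rw [iteratedFDerivWithin_succ_apply_right hopen.uniqueDiffOn hx]
    have hcomp := (-(ContinuousLinearMap.apply ℝ ℝ w)).iteratedFDerivWithin_comp_left
      (hs' x hx) hopen.uniqueDiffOn hx hle
    have hfun : (fun y => -fderivWithin ℝ f C y w) =
        (-(ContinuousLinearMap.apply ℝ ℝ w)) ∘ fderivWithin ℝ f C := by
      ext y
      simp
    rw [hfun, hcomp] at key
    simpa [pow_succ] using key

lemma completelyMonotoneOn_iff (hopen : IsOpen C)
    (hadd : ∀ x ∈ C, ∀ u ∈ C, x + u ∈ C) (hcone : ∀ x ∈ C, ∀ t : ℝ, 0 < t → t • x ∈ C) :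
    CompletelyMonotoneOn f C ↔ ContDiffOn ℝ (⊤ : ℕ∞) f C ∧ AltDiffNonneg C f :=
  ⟨fun h => ⟨h.1, h.altDiffNonneg hopen hadd hcone⟩,
    fun h => h.2.completelyMonotoneOn hopen hadd hcone h.1⟩

end CompletelyMonotone

section Slices

lemma add_mem_prod_Ioi {E : Type*} [AddCommGroup E] {C : Set E}
    (hadd : ∀ x ∈ C, ∀ u ∈ C, x + u ∈ C) :
    ∀ p ∈ C ×ˢ Ioi (0 : ℝ), ∀ q ∈ C ×ˢ Ioi (0 : ℝ), p + q ∈ C ×ˢ Ioi (0 : ℝ) :=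
  fun _ hp _ hq => ⟨hadd _ hp.1 _ hq.1, add_pos (mem_Ioi.1 hp.2) (mem_Ioi.1 hq.2)⟩

variable {E : Type*} [NormedAddCommGroup E] {C : Set E}

lemma AltDiffNonneg.sub_shift_of_tendsto {ι : Type*} {F : Filter ι} [F.NeBot]
    {f : E → ℝ} (hadd : ∀ x ∈ C, ∀ u ∈ C, x + u ∈ C) (hopen : IsOpen C) (hf : AltDiffNonneg C f)
    (hcont : ContinuousOn f C) {w : ι → E} {w₀ : E} (hw : ∀ᶠ i in F, w i ∈ C)
    (hlim : Tendsto w F (𝓝 w₀)) (hw₀ : ∀ x ∈ C, x + w₀ ∈ C) :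
    AltDiffNonneg C (fun x => f x - f (x + w₀)) := by
  refine of_tendsto (F := F) (f := fun i x => f x - f (x + w i)) hadd
    (hw.mono fun i hi => hf.sub_shift hi) fun x hx => ?_
  exact tendsto_const_nhds.sub
    ((hcont.continuousAt (hopen.mem_nhds (hw₀ x hx))).tendsto.comp (hlim.const_add x))

lemma AltDiffNonneg.slice (hopen : IsOpen C) (hadd : ∀ x ∈ C, ∀ u ∈ C, x + u ∈ C)
    {f : E × ℝ → ℝ} (hf : AltDiffNonneg (C ×ˢ Ioi (0 : ℝ)) f)
    (hcont : ContinuousOn f (C ×ˢ Ioi (0 : ℝ))) {z : ℝ} (hz : 0 < z) :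
    AltDiffNonneg C (fun x => f (x, z)) := by
  intro l
  induction l generalizing f with
  | nil => exact fun _ x hx => hf.nonneg ⟨hx, hz⟩
  | cons u l ih =>
    intro hl x hx
    rw [List.forall_mem_cons] at hl
    have hmem : ∀ p ∈ C ×ˢ Ioi (0 : ℝ), p + (u, 0) ∈ C ×ˢ Ioi (0 : ℝ) := fun p hp =>
      ⟨hadd _ hp.1 _ hl.1, by simpa using hp.2⟩
    have hlim : Tendsto (fun c : ℝ => (u, c)) (𝓝[>] 0) (𝓝 (u, 0)) :=
      tendsto_const_nhds.prodMk_nhds (tendsto_id.mono_left nhdsWithin_le_nhds)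
    have hev : ∀ᶠ c in 𝓝[>] (0 : ℝ), (u, c) ∈ C ×ˢ Ioi (0 : ℝ) := by
      filter_upwards [self_mem_nhdsWithin] with c hc using ⟨hl.1, hc⟩
    have hshift := hf.sub_shift_of_tendsto (add_mem_prod_Ioi hadd) (hopen.prod isOpen_Ioi) hcont
      hev hlim hmem
    have hc := hcont.sub (hcont.comp (f := fun p : E × ℝ => p + (u, 0)) (by fun_prop) hmem)
    simpa [altDiff] using ih hshift hc hl.2 x hx

variable [NormedSpace ℝ E]

lemma smul_mem_prod_Ioi (hcone : ∀ x ∈ C, ∀ t : ℝ, 0 < t → t • x ∈ C) :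
    ∀ p ∈ C ×ˢ Ioi (0 : ℝ), ∀ t : ℝ, 0 < t → t • p ∈ C ×ˢ Ioi (0 : ℝ) :=
  fun _ hp _ ht => ⟨hcone _ hp.1 _ ht, mul_pos ht hp.2⟩

lemma AltDiffNonneg.sub_shift_snd (hne : C.Nonempty) (hopen : IsOpen C)
    (hadd : ∀ x ∈ C, ∀ u ∈ C, x + u ∈ C) (hcone : ∀ x ∈ C, ∀ t : ℝ, 0 < t → t • x ∈ C)
    {f : E × ℝ → ℝ} (hf : AltDiffNonneg (C ×ˢ Ioi (0 : ℝ)) f)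
    (hcont : ContinuousOn f (C ×ˢ Ioi (0 : ℝ))) {c : ℝ} (hc : 0 < c) :
    AltDiffNonneg (C ×ˢ Ioi (0 : ℝ)) (fun p => f p - f (p + (0, c))) := by
  obtain ⟨v, hv⟩ := hne
  have hlim : Tendsto (fun s : ℝ => (s • v, c)) (𝓝[>] 0) (𝓝 (0, c)) := by
    refine Tendsto.prodMk_nhds ?_ tendsto_const_nhds
    have : Continuous fun s : ℝ => s • v := by fun_prop
    simpa using this.continuousWithinAt (s := Ioi 0) (x := 0) |>.tendsto
  have hev : ∀ᶠ s in 𝓝[>] (0 : ℝ), (s • v, c) ∈ C ×ˢ Ioi (0 : ℝ) := by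
    filter_upwards [self_mem_nhdsWithin] with s hs using ⟨hcone v hv s hs, hc⟩
  refine hf.sub_shift_of_tendsto (add_mem_prod_Ioi hadd) (hopen.prod isOpen_Ioi) hcont hev hlim
    fun p hp => ?_
  exact ⟨by simpa using hp.1, add_pos (mem_Ioi.1 hp.2) hc⟩

end Slices

section AffineSection

lemma rpow_mul_div_add_rpow {a b : ℝ} (ha : 0 < a) (hb : 0 < b) {z : ℝ} (hz : 0 ≤ z) (β κ : ℝ) :
    b ^ (-β) * (a / b + z) ^ (-(β + κ)) = b ^ κ * (a + z * b) ^ (-(β + κ)) := by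
  have h : a / b + z = (a + z * b) / b := by field_simp
  rw [h, Real.div_rpow (by positivity) hb.le, mul_div_left_comm, ← Real.rpow_sub hb, mul_comm]
  congr 2
  ring

lemma rpow_neg_eq_integral {a r : ℝ} (ha : 0 < a) (hr : 0 < r) :
    r ^ (-a) = (Real.Gamma a)⁻¹ * ∫ t in Ioi (0 : ℝ), t ^ (a - 1) * Real.exp (-(t * r)) := by
  simp_rw [mul_comm _ r]
  rw [Real.integral_rpow_mul_exp_neg_mul_Ioi ha hr, Real.rpow_neg hr.le, one_div,
    Real.inv_rpow hr.le, mul_comm, mul_inv_cancel_right₀ (Real.Gamma_pos_of_pos ha).ne']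

lemma integrableOn_rpow_mul_exp_neg_mul {a r : ℝ} (ha : 0 < a) (hr : 0 < r) :
    IntegrableOn (fun t : ℝ => t ^ (a - 1) * Real.exp (-(t * r))) (Ioi 0) := by
  by_contra h
  have := rpow_neg_eq_integral ha hr
  rw [integral_undef h, mul_zero] at this
  exact (Real.rpow_pos_of_pos hr _).ne' this

lemma AltDiffNonneg.mul_rpow_neg {E : Type*} [AddCommGroup E] {C : Set E}
    (hadd : ∀ x ∈ C, ∀ u ∈ C, x + u ∈ C) {p r : E → ℝ} (hr : ∀ x ∈ C, 0 < r x)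
    (h : ∀ t : ℝ, 0 ≤ t → AltDiffNonneg C (fun x => p x * Real.exp (-(t * r x))))
    {a : ℝ} (ha : 0 ≤ a) : AltDiffNonneg C (fun x => p x * r x ^ (-a)) := by
  rcases ha.eq_or_lt with rfl | ha
  · simpa using h 0 le_rfl
  have hint : AltDiffNonneg C (fun x => ∫ t in Ioi (0 : ℝ),
      t ^ (a - 1) * (p x * Real.exp (-(t * r x)))) := by
    refine AltDiffNonneg.integral hadd ?_ fun x hx => ?_
    · filter_upwards [ae_restrict_mem measurableSet_Ioi] with t ht
      exact (h t (le_of_lt ht)).const_mul (Real.rpow_nonneg (le_of_lt ht) _)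
    · simpa only [mul_left_comm] using
        (integrableOn_rpow_mul_exp_neg_mul ha (hr x hx)).const_mul (p x)
  refine (hint.const_mul (inv_nonneg.2 (Real.Gamma_pos_of_pos ha).le)).congr hadd fun x hx => ?_
  simp only [rpow_neg_eq_integral ha (hr x hx), mul_left_comm _ (p x), integral_const_mul]

lemma contDiffOn_of_rpow {E : Type*} [NormedAddCommGroup E] [NormedSpace ℝ E] {C : Set E}
    {g : E → ℝ} (hg : ∀ x ∈ C, 0 < g x) {a : ℝ} (ha : a ≠ 0) {n : WithTop ℕ∞}
    (h : ContDiffOn ℝ n (fun x => g x ^ a) C) : ContDiffOn ℝ n g C :=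
  (h.rpow_const_of_ne (p := a⁻¹) fun x hx => (Real.rpow_pos_of_pos (hg x hx) _).ne').congr
    fun x hx => (Real.rpow_rpow_inv (hg x hx).le ha).symm

lemma tendsto_one_add_div_rpow_neg (β s : ℝ) :
    Tendsto (fun k : ℕ => (1 + s / k) ^ (-(β + (k : ℝ)))) atTop (𝓝 (Real.exp (-s))) := by
  have h0 : Tendsto (fun k : ℕ => 1 + s / (k : ℝ)) atTop (𝓝 1) := by
    simpa using (tendsto_const_div_atTop_nhds_zero_nat s).const_add 1
  have h1 : Tendsto (fun k : ℕ => (1 + s / (k : ℝ)) ^ (-β)) atTop (𝓝 1) := by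
    simpa using h0.rpow_const (p := -β) (Or.inl one_ne_zero)
  have h2 := h1.mul ((Real.tendsto_one_add_div_pow_exp s).inv₀ (Real.exp_pos s).ne')
  rw [one_mul, ← Real.exp_neg] at h2
  refine h2.congr' ?_
  filter_upwards [h0.eventually_const_lt one_pos] with k hk
  rw [neg_add, Real.rpow_add hk, Real.rpow_neg hk.le (k : ℝ), Real.rpow_natCast]

section Algebraic

variable {V : Type*} [AddCommGroup V] {C : Set V} {β : ℝ} {A B : V → ℝ}

lemma altDiffNonneg_rpow_mul_exp (hadd : ∀ x ∈ C, ∀ u ∈ C, x + u ∈ C)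
    (hA : ∀ x ∈ C, 0 < A x) (hB : ∀ x ∈ C, 0 < B x)
    (h : ∀ k : ℕ, ∀ z : ℝ, 0 ≤ z → AltDiffNonneg C
      (fun x => B x ^ (k : ℝ) * (A x + z * B x) ^ (-(β + (k : ℝ)))))
    {t : ℝ} (ht : 0 ≤ t) :
    AltDiffNonneg C (fun x => B x ^ (-β) * Real.exp (-(t * A x / B x))) := by
  have hpos : ∀ t : ℝ, 0 < t →
      AltDiffNonneg C (fun x => B x ^ (-β) * Real.exp (-(t * A x / B x))) := by
    intro t ht
    refine AltDiffNonneg.of_tendsto (F := atTop)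
      (f := fun (k : ℕ) x => B x ^ (-β) * (1 + t * A x / B x / k) ^ (-(β + (k : ℝ)))) hadd ?_
      fun x hx => (tendsto_one_add_div_rpow_neg β _).const_mul _
    filter_upwards [eventually_gt_atTop 0] with k hk
    have hk : (0 : ℝ) < k := by exact_mod_cast hk
    refine ((h k (k / t) (by positivity)).const_mul
      (Real.rpow_nonneg (div_pos hk ht).le (β + k))).congr hadd fun x hx => ?_
    have hAx := hA x hx
    have hBx := hB x hx
    have hzt : 1 + t * A x / B x / k = (A x / B x + k / t) / (k / t) := by
      field_simp
      ring
    rw [← rpow_mul_div_add_rpow hAx hBx (by positivity), hzt,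
      Real.div_rpow (x := A x / B x + k / t) (by positivity) (by positivity),
      Real.rpow_neg (div_pos hk ht).le, div_inv_eq_mul]
    ring
  refine AltDiffNonneg.of_tendsto (F := 𝓝[>] t)
    (f := fun s x => B x ^ (-β) * Real.exp (-(s * A x / B x))) hadd ?_ fun x _ => ?_
  · filter_upwards [self_mem_nhdsWithin] with s hs using hpos s (ht.trans_lt hs)
  · have hc : Continuous fun s : ℝ => B x ^ (-β) * Real.exp (-(s * A x / B x)) := by fun_prop
    exact hc.continuousAt.tendsto.mono_left nhdsWithin_le_nhds

lemma altDiffNonneg_affine_of_exp (hadd : ∀ x ∈ C, ∀ u ∈ C, x + u ∈ C) (hβ : 0 < β)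
    (hA : ∀ x ∈ C, 0 < A x) (hB : ∀ x ∈ C, 0 < B x)
    (h : ∀ t : ℝ, 0 ≤ t →
      AltDiffNonneg C (fun x => B x ^ (-β) * Real.exp (-(t * A x / B x)))) :
    AltDiffNonneg (C ×ˢ Ioi (0 : ℝ)) (fun p : V × ℝ => (A p.1 + B p.1 * p.2) ^ (-β)) := by
  refine (AltDiffNonneg.mul_rpow_neg (add_mem_prod_Ioi hadd) (p := fun p : V × ℝ => B p.1 ^ (-β))
    (r := fun p => A p.1 / B p.1 + p.2) (a := β)
    (fun p hp => add_pos (div_pos (hA _ hp.1) (hB _ hp.1)) hp.2) (fun t ht => ?_) hβ.le).congr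
    (add_mem_prod_Ioi hadd) fun p hp => ?_
  · refine ((h t ht).mul_exp_neg ht).congr (add_mem_prod_Ioi hadd) fun p _ => ?_
    simp only [mul_assoc, ← Real.exp_add]
    congr 2
    ring
  · have := rpow_mul_div_add_rpow (hA _ hp.1) (hB _ hp.1) (le_of_lt hp.2) β 0
    simpa [mul_comm p.2] using this

lemma altDiffNonneg_rpow_mul_rpow_of_exp (hadd : ∀ x ∈ C, ∀ u ∈ C, x + u ∈ C)
    (hA : ∀ x ∈ C, 0 < A x) (hB : ∀ x ∈ C, 0 < B x)
    (h : ∀ t : ℝ, 0 ≤ t →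
      AltDiffNonneg C (fun x => B x ^ (-β) * Real.exp (-(t * A x / B x))))
    {κ : ℝ} (hκ : -β ≤ κ) {z : ℝ} (hz : 0 ≤ z) :
    AltDiffNonneg C (fun x => B x ^ κ * (A x + z * B x) ^ (-(β + κ))) := by
  refine (AltDiffNonneg.mul_rpow_neg hadd (p := fun x => B x ^ (-β))
    (r := fun x => A x / B x + z) (a := β + κ)
    (fun x hx => add_pos_of_pos_of_nonneg (div_pos (hA x hx) (hB x hx)) hz) (fun t ht => ?_)
    (by linarith)).congr hadd fun x hx => rpow_mul_div_add_rpow (hA x hx) (hB x hx) hz β κ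
  refine ((h t ht).const_mul (Real.exp_pos (-(t * z))).le).congr hadd fun x _ => ?_
  simp only [mul_left_comm _ (B x ^ (-β)), ← Real.exp_add]
  congr 2
  ring

end Algebraic

variable {V : Type*} [NormedAddCommGroup V] [NormedSpace ℝ V] {C : Set V} {β : ℝ} {A B : V → ℝ}

lemma altDiffNonneg_rpow_mul_rpow_of_affine (hne : C.Nonempty) (hopen : IsOpen C)
    (hadd : ∀ x ∈ C, ∀ u ∈ C, x + u ∈ C) (hcone : ∀ x ∈ C, ∀ t : ℝ, 0 < t → t • x ∈ C)
    (hβ : 0 < β) (hA : ∀ x ∈ C, 0 < A x) (hB : ∀ x ∈ C, 0 < B x)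
    (hAc : ContinuousOn A C) (hBc : ContinuousOn B C)
    (h : AltDiffNonneg (C ×ˢ Ioi (0 : ℝ)) (fun p : V × ℝ => (A p.1 + B p.1 * p.2) ^ (-β)))
    (k : ℕ) {z : ℝ} (hz : 0 ≤ z) :
    AltDiffNonneg C (fun x => B x ^ (k : ℝ) * (A x + z * B x) ^ (-(β + (k : ℝ)))) := by
  have hpos : ∀ p ∈ C ×ˢ Ioi (0 : ℝ), 0 < A p.1 + B p.1 * p.2 := fun p hp =>
    add_pos (hA _ hp.1) (mul_pos (hB _ hp.1) hp.2)
  have hcont : ∀ k : ℕ, ContinuousOn (fun p : V × ℝ =>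
      B p.1 ^ (k : ℝ) * (A p.1 + B p.1 * p.2) ^ (-(β + (k : ℝ)))) (C ×ˢ Ioi (0 : ℝ)) := by
    intro k
    have hA' : ContinuousOn (fun p : V × ℝ => A p.1) (C ×ˢ Ioi (0 : ℝ)) :=
      hAc.comp continuousOn_fst fun p hp => hp.1
    have hB' : ContinuousOn (fun p : V × ℝ => B p.1) (C ×ˢ Ioi (0 : ℝ)) :=
      hBc.comp continuousOn_fst fun p hp => hp.1
    exact (hB'.rpow_const fun p hp => Or.inl (hB _ hp.1).ne').mul
      ((hA'.add (hB'.mul continuousOn_snd)).rpow_const fun p hp => Or.inl (hpos p hp).ne')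
  have hk : ∀ k : ℕ, AltDiffNonneg (C ×ˢ Ioi (0 : ℝ)) (fun p : V × ℝ =>
      B p.1 ^ (k : ℝ) * (A p.1 + B p.1 * p.2) ^ (-(β + (k : ℝ)))) := by
    intro k
    induction k with
    | zero => simpa using h
    | succ k ih =>
      have hβk : 0 < β + k := by positivity
      have hder := AltDiffNonneg.neg_lineDeriv (add_mem_prod_Ioi hadd) (w := ((0 : V), (1 : ℝ)))
        (f := fun p => B p.1 ^ (k : ℝ) * (A p.1 + B p.1 * p.2) ^ (-(β + (k : ℝ))))
        (g := fun p => -((β + k) * (B p.1 ^ ((k + 1 : ℕ) : ℝ) *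
          (A p.1 + B p.1 * p.2) ^ (-(β + ((k + 1 : ℕ) : ℝ))))))
        (fun c hc => by
          simpa using ih.sub_shift_snd hne hopen hadd hcone (hcont k) hc)
        (fun p hp => by
          have h1 : HasDerivAt (fun c : ℝ => A p.1 + B p.1 * (p.2 + c)) (B p.1) 0 := by
            simpa using (((hasDerivAt_id (0 : ℝ)).const_add p.2).const_mul (B p.1)).const_add
              (A p.1)
          have h2 := (h1.rpow_const (p := -(β + k))
            (Or.inl (by simpa using (hpos p hp).ne'))).const_mul (B p.1 ^ (k : ℝ))
          simp only [Prod.fst_add, Prod.snd_add, Prod.smul_mk, smul_zero, add_zero, smul_eq_mul,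
            mul_one]
          refine h2.congr_deriv ?_
          rw [add_zero, Nat.cast_succ, Real.rpow_add_one (hB _ hp.1).ne',
            show -(β + k) - 1 = -(β + ((k : ℝ) + 1)) by ring]
          ring)
      refine (hder.const_mul (inv_nonneg.2 hβk.le)).congr (add_mem_prod_Ioi hadd) fun p _ => ?_
      simp only [neg_neg]
      rw [inv_mul_cancel_left₀ hβk.ne']
  refine AltDiffNonneg.of_tendsto (F := 𝓝[>] z) (f := fun s x =>
    B x ^ (k : ℝ) * (A x + s * B x) ^ (-(β + (k : ℝ)))) hadd ?_ fun x hx => ?_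
  · filter_upwards [self_mem_nhdsWithin] with s hs
    simpa only [mul_comm s] using (hk k).slice hopen hadd (hcont k) (hz.trans_lt hs)
  · have hpos' : A x + z * B x ≠ 0 := (add_pos_of_pos_of_nonneg (hA x hx)
      (mul_nonneg hz (hB x hx).le)).ne'
    have hc : ContinuousAt (fun s : ℝ => B x ^ (k : ℝ) * (A x + s * B x) ^ (-(β + (k : ℝ)))) z :=
      ContinuousAt.mul continuousAt_const (ContinuousAt.rpow_const (by fun_prop) (Or.inl hpos'))
    exact hc.tendsto.mono_left nhdsWithin_le_nhds

lemma contDiffOn_of_contDiffOn_affine {n : WithTop ℕ∞} (hβ : 0 < β) (hA : ∀ x ∈ C, 0 < A x)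
    (hB : ∀ x ∈ C, 0 < B x)
    (h : ContDiffOn ℝ n (fun p : V × ℝ => (A p.1 + B p.1 * p.2) ^ (-β)) (C ×ˢ Ioi (0 : ℝ))) :
    ContDiffOn ℝ n A C ∧ ContDiffOn ℝ n B C := by
  have hy : ∀ y : ℝ, 0 < y → ContDiffOn ℝ n (fun x => A x + B x * y) C := fun y hy =>
    contDiffOn_of_rpow (fun x hx => add_pos (hA x hx) (mul_pos (hB x hx) hy))
      (neg_ne_zero.2 hβ.ne') (h.comp (f := fun x : V => (x, y)) (by fun_prop)
        fun x hx => ⟨hx, hy⟩)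
  have hBs : ContDiffOn ℝ n B C :=
    ((hy 2 two_pos).sub (hy 1 one_pos)).congr fun x _ => by ring
  exact ⟨((hy 1 one_pos).sub hBs).congr fun x _ => by ring, hBs⟩

lemma contDiffOn_of_contDiffOn_exp {n : WithTop ℕ∞} (hβ : 0 < β) (hB : ∀ x ∈ C, 0 < B x)
    (h : ∀ t : ℝ, 0 ≤ t →
      ContDiffOn ℝ n (fun x => B x ^ (-β) * Real.exp (-(t * A x / B x))) C) :
    ContDiffOn ℝ n A C ∧ ContDiffOn ℝ n B C := by
  have hBs : ContDiffOn ℝ n B C :=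
    contDiffOn_of_rpow hB (neg_ne_zero.2 hβ.ne') (by simpa using h 0 le_rfl)
  have hlog := (h 1 zero_le_one).log fun x hx =>
    (mul_pos (Real.rpow_pos_of_pos (hB x hx) (-β)) (Real.exp_pos _)).ne'
  have hlogB := hBs.log fun x hx => (hB x hx).ne'
  refine ⟨(((hlogB.const_smul (-β)).sub hlog).mul hBs).congr fun x hx => ?_, hBs⟩
  have hBx := hB x hx
  simp only [smul_eq_mul]
  rw [Real.log_mul (Real.rpow_pos_of_pos hBx (-β)).ne' (Real.exp_pos _).ne',
    Real.log_rpow hBx, Real.log_exp]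
  field_simp
  ring

lemma contDiffOn_of_contDiffOn_rpow {n : WithTop ℕ∞} (hβ : 0 < β) (hA : ∀ x ∈ C, 0 < A x)
    (hB : ∀ x ∈ C, 0 < B x)
    (h : ∀ z : ℝ, 0 ≤ z → ContDiffOn ℝ n (fun x => (A x + z * B x) ^ (-β)) C) :
    ContDiffOn ℝ n A C ∧ ContDiffOn ℝ n B C := by
  have hz : ∀ z : ℝ, 0 ≤ z → ContDiffOn ℝ n (fun x => A x + z * B x) C := fun z hz =>
    contDiffOn_of_rpow (fun x hx => add_pos_of_pos_of_nonneg (hA x hx)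
      (mul_nonneg hz (hB x hx).le)) (neg_ne_zero.2 hβ.ne') (h z hz)
  have hAs : ContDiffOn ℝ n A C := by simpa using hz 0 le_rfl
  exact ⟨hAs, ((hz 1 zero_le_one).sub hAs).congr fun x _ => by ring⟩

end AffineSection

/-- Let `C` be an open convex cone in a finite-dimensional real vector
space `V`, `β > 0`, and `A, B : C → (0,∞)`.  Then the complete monotonicity on
`C × (0,∞)` of `(A(x)+B(x)y)^{-β}` is equivalent to each of: (b) complete monotonicity on
`C` of `B^{-β} exp(−tA/B)` for all `t ≥ 0`; (c) complete monotonicity on `C` of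
`B^κ (A+zB)^{-(β+κ)}` for all `κ ≥ −β`, `z ≥ 0`; (d) the same for integer `κ = k ≥ 0`. -/
theorem completely_monotone_affine_section_tfae
    {V : Type*} [NormedAddCommGroup V] [NormedSpace ℝ V] [FiniteDimensional ℝ V]
    (C : Set V) (hne : C.Nonempty) (hopen : IsOpen C) (hconv : Convex ℝ C)
    (hcone : ∀ x ∈ C, ∀ t : ℝ, 0 < t → t • x ∈ C)
    (β : ℝ) (hβ : 0 < β)
    (A B : V → ℝ) (hA : ∀ x ∈ C, 0 < A x) (hB : ∀ x ∈ C, 0 < B x) :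
    (CompletelyMonotoneOn (fun p : V × ℝ => (A p.1 + B p.1 * p.2) ^ (-β))
        (C ×ˢ Set.Ioi (0 : ℝ))
      ↔ ∀ t : ℝ, 0 ≤ t →
          CompletelyMonotoneOn (fun x => B x ^ (-β) * Real.exp (-(t * A x / B x))) C) ∧
    (CompletelyMonotoneOn (fun p : V × ℝ => (A p.1 + B p.1 * p.2) ^ (-β))
        (C ×ˢ Set.Ioi (0 : ℝ))
      ↔ ∀ κ : ℝ, -β ≤ κ → ∀ z : ℝ, 0 ≤ z →
          CompletelyMonotoneOn (fun x => B x ^ κ * (A x + z * B x) ^ (-(β + κ))) C) ∧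
    (CompletelyMonotoneOn (fun p : V × ℝ => (A p.1 + B p.1 * p.2) ^ (-β))
        (C ×ˢ Set.Ioi (0 : ℝ))
      ↔ ∀ k : ℕ, ∀ z : ℝ, 0 ≤ z →
          CompletelyMonotoneOn
            (fun x => B x ^ (k : ℝ) * (A x + z * B x) ^ (-(β + (k : ℝ)))) C) := by
  have hadd : ∀ x ∈ C, ∀ u ∈ C, x + u ∈ C := fun x hx u hu => by
    have hmid := hcone _ (hconv hx hu (by norm_num : (0 : ℝ) ≤ 1 / 2)
      (by norm_num : (0 : ℝ) ≤ 1 / 2) (by norm_num)) 2 two_pos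
    simpa [smul_smul] using hmid
  have hD := completelyMonotoneOn_iff (f := fun p : V × ℝ => (A p.1 + B p.1 * p.2) ^ (-β))
    (hopen.prod isOpen_Ioi) (add_mem_prod_Ioi hadd) (smul_mem_prod_Ioi hcone)
  simp only [hD, completelyMonotoneOn_iff hopen hadd hcone]
  have affine_smooth : ContDiffOn ℝ (⊤ : ℕ∞) A C → ContDiffOn ℝ (⊤ : ℕ∞) B C →
      ContDiffOn ℝ (⊤ : ℕ∞) (fun p : V × ℝ => (A p.1 + B p.1 * p.2) ^ (-β))
        (C ×ˢ Ioi (0 : ℝ)) := fun hAs hBs =>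
    ((hAs.comp contDiffOn_fst fun p hp => hp.1).add
      ((hBs.comp contDiffOn_fst fun p hp => hp.1).mul contDiffOn_snd)).rpow_const_of_ne
      fun p hp => (add_pos (hA _ hp.1) (mul_pos (hB _ hp.1) hp.2)).ne'
  have exp_smooth : ContDiffOn ℝ (⊤ : ℕ∞) A C → ContDiffOn ℝ (⊤ : ℕ∞) B C → ∀ t : ℝ,
      ContDiffOn ℝ (⊤ : ℕ∞) (fun x => B x ^ (-β) * Real.exp (-(t * A x / B x))) C :=
    fun hAs hBs t => (hBs.rpow_const_of_ne fun x hx => (hB x hx).ne').mul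
      ((contDiffOn_const.mul hAs).div hBs fun x hx => (hB x hx).ne').neg.exp
  have rpow_smooth : ContDiffOn ℝ (⊤ : ℕ∞) A C → ContDiffOn ℝ (⊤ : ℕ∞) B C → ∀ κ z : ℝ, 0 ≤ z →
      ContDiffOn ℝ (⊤ : ℕ∞) (fun x => B x ^ κ * (A x + z * B x) ^ (-(β + κ))) C :=
    fun hAs hBs κ z hz => (hBs.rpow_const_of_ne fun x hx => (hB x hx).ne').mul
      ((hAs.add (contDiffOn_const.mul hBs)).rpow_const_of_ne fun x hx =>
        (add_pos_of_pos_of_nonneg (hA x hx) (mul_nonneg hz (hB x hx).le)).ne')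
  have cycle : ∀ {a b c d : Prop}, (a → d) → (d → b) → (b → a) → (b → c) → (c → d) →
      (a ↔ b) ∧ (a ↔ c) ∧ (a ↔ d) :=
    fun ad db ba bc cd => ⟨⟨fun h => db (ad h), ba⟩,
      ⟨fun h => bc (db (ad h)), fun h => ba (db (cd h))⟩, ⟨ad, fun h => ba (db h)⟩⟩
  refine cycle ?_ ?_ ?_ ?_ ?_
  · rintro ⟨hs, h⟩ k z hz
    obtain ⟨hAs, hBs⟩ := contDiffOn_of_contDiffOn_affine hβ hA hB hs
    exact ⟨rpow_smooth hAs hBs k z hz, altDiffNonneg_rpow_mul_rpow_of_affine hne hopen hadd hcone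
      hβ hA hB hAs.continuousOn hBs.continuousOn h k hz⟩
  · intro h t ht
    obtain ⟨hAs, hBs⟩ := contDiffOn_of_contDiffOn_rpow hβ hA hB fun z hz => by
      simpa using (h 0 z hz).1
    exact ⟨exp_smooth hAs hBs t, altDiffNonneg_rpow_mul_exp hadd hA hB
      (fun k z hz => (h k z hz).2) ht⟩
  · intro h
    obtain ⟨hAs, hBs⟩ := contDiffOn_of_contDiffOn_exp hβ hB fun t ht => (h t ht).1
    exact ⟨affine_smooth hAs hBs, altDiffNonneg_affine_of_exp hadd hβ hA hB
      fun t ht => (h t ht).2⟩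
  · intro h κ hκ z hz
    obtain ⟨hAs, hBs⟩ := contDiffOn_of_contDiffOn_exp hβ hB fun t ht => (h t ht).1
    exact ⟨rpow_smooth hAs hBs κ z hz, altDiffNonneg_rpow_mul_rpow_of_exp hadd hA hB
      (fun t ht => (h t ht).2) hκ hz⟩
  · exact fun h k z hz => h k (by linarith [(Nat.cast_nonneg k : (0 : ℝ) ≤ k)]) z hz
end

section
/- Let C be an open convex cone in a finite-dimensional real vector space V, fix β > 0, and let A, B, C', D : C → (0,∞). Suppose that the functions (x,y) ↦ (A(x) + B(x)y)^{-β} and (x,y) ↦ (C'(x) + D(x)y)^{-β} are completely monotone on C × (0,∞). Then the function (x,y) ↦ (A(x)D(x) + B(x)C'(x) + B(x)D(x)y)^{-β} is completely monotone on C × (0,∞). -/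
open MeasureTheory Filter Topology

/-- Nonnegativity on `C` of all iterated differences `f ↦ f x - f (x + u)`, `u ∈ C`, of order
at most `n`. -/
def DifferencesNonneg {E : Type*} [AddCommGroup E] (C : Set E) : ℕ → (E → ℝ) → Prop
  | 0, f => ∀ x ∈ C, 0 ≤ f x
  | n + 1, f => (∀ x ∈ C, 0 ≤ f x) ∧
      ∀ u ∈ C, DifferencesNonneg C n (fun x => f x - f (x + u))

namespace DifferencesNonneg

section Group

variable {E : Type*} [AddCommGroup E] {C : Set E}

theorem nonneg {n : ℕ} {f : E → ℝ} (h : DifferencesNonneg C n f) : ∀ x ∈ C, 0 ≤ f x := by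
  cases n with
  | zero => exact h
  | succ n => exact h.1

theorem of_succ {n : ℕ} {f : E → ℝ} (h : DifferencesNonneg C (n + 1) f) :
    DifferencesNonneg C n f := by
  induction n generalizing f with
  | zero => exact h.1
  | succ n ih => exact ⟨h.1, fun u hu => ih (h.2 u hu)⟩

theorem congr (hadd : ∀ x ∈ C, ∀ y ∈ C, x + y ∈ C) {n : ℕ} {f g : E → ℝ}
    (hf : DifferencesNonneg C n f) (hfg : ∀ x ∈ C, f x = g x) : DifferencesNonneg C n g := by
  induction n generalizing f g with
  | zero => exact fun x hx => hfg x hx ▸ hf x hx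
  | succ n ih =>
    refine ⟨fun x hx => hfg x hx ▸ hf.1 x hx, fun u hu => ih (hf.2 u hu) fun x hx => ?_⟩
    simp only [hfg x hx, hfg _ (hadd x hx u hu)]

theorem add {n : ℕ} {f g : E → ℝ} (hf : DifferencesNonneg C n f)
    (hg : DifferencesNonneg C n g) : DifferencesNonneg C n (fun x => f x + g x) := by
  induction n generalizing f g with
  | zero => exact fun x hx => add_nonneg (hf x hx) (hg x hx)
  | succ n ih =>
    refine ⟨fun x hx => add_nonneg (hf.1 x hx) (hg.1 x hx), fun u hu => ?_⟩
    convert ih (hf.2 u hu) (hg.2 u hu) using 2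
    ring

theorem const_mul {n : ℕ} {f : E → ℝ} {c : ℝ} (hc : 0 ≤ c) (hf : DifferencesNonneg C n f) :
    DifferencesNonneg C n (fun x => c * f x) := by
  induction n generalizing f with
  | zero => exact fun x hx => mul_nonneg hc (hf x hx)
  | succ n ih =>
    refine ⟨fun x hx => mul_nonneg hc (hf.1 x hx), fun u hu => ?_⟩
    convert ih (hf.2 u hu) using 2
    ring

theorem comp_affine {T L : E → E} (hT : ∀ x ∈ C, T x ∈ C) (hL : ∀ u ∈ C, L u ∈ C)
    (hTL : ∀ x u, T (x + u) = T x + L u) {n : ℕ} {f : E → ℝ}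
    (hf : DifferencesNonneg C n f) : DifferencesNonneg C n (fun x => f (T x)) := by
  induction n generalizing f with
  | zero => exact fun x hx => hf _ (hT x hx)
  | succ n ih =>
    refine ⟨fun x hx => hf.1 _ (hT x hx), fun u hu => ?_⟩
    simp only [hTL]
    exact ih (hf.2 (L u) (hL u hu))

theorem comp_add_right {n : ℕ} {f : E → ℝ} {s : E} (hs : ∀ x ∈ C, x + s ∈ C)
    (hf : DifferencesNonneg C n f) : DifferencesNonneg C n (fun x => f (x + s)) :=
  comp_affine (T := fun x => x + s) (L := fun u => u) hs (fun _ hu => hu)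
    (fun x u => add_right_comm x u s) hf

theorem mul (hadd : ∀ x ∈ C, ∀ y ∈ C, x + y ∈ C) {n : ℕ} {f g : E → ℝ}
    (hf : DifferencesNonneg C n f) (hg : DifferencesNonneg C n g) :
    DifferencesNonneg C n (fun x => f x * g x) := by
  induction n generalizing f g with
  | zero => exact fun x hx => mul_nonneg (hf x hx) (hg x hx)
  | succ n ih =>
    refine ⟨fun x hx => mul_nonneg (hf.1 x hx) (hg.1 x hx), fun u hu => ?_⟩
    convert (ih (hf.2 u hu) hg.of_succ).add
      (ih (hf.of_succ.comp_add_right fun x hx => hadd x hx u hu) (hg.2 u hu)) using 2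
    ring

theorem of_tendsto (hadd : ∀ x ∈ C, ∀ y ∈ C, x + y ∈ C) {ι : Type*} {l : Filter ι} [l.NeBot]
    {n : ℕ} {F : ι → E → ℝ} {f : E → ℝ} (hF : ∀ᶠ i in l, DifferencesNonneg C n (F i))
    (hlim : ∀ x ∈ C, Tendsto (fun i => F i x) l (𝓝 (f x))) : DifferencesNonneg C n f := by
  induction n generalizing F f with
  | zero => exact fun x hx => ge_of_tendsto (hlim x hx) (hF.mono fun i hi => hi x hx)
  | succ n ih =>
    refine ⟨fun x hx => ge_of_tendsto (hlim x hx) (hF.mono fun i hi => hi.1 x hx),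
      fun u hu => ?_⟩
    exact ih (hF.mono fun i hi => hi.2 u hu)
      fun x hx => (hlim x hx).sub (hlim _ (hadd x hx u hu))

theorem setIntegral (hadd : ∀ x ∈ C, ∀ y ∈ C, x + y ∈ C) {S : Set ℝ} (hS : MeasurableSet S)
    {n : ℕ} {F : ℝ → E → ℝ} (hF : ∀ t ∈ S, DifferencesNonneg C n (F t))
    (hint : ∀ x ∈ C, IntegrableOn (fun t => F t x) S) :
    DifferencesNonneg C n (fun x => ∫ t in S, F t x) := by
  induction n generalizing F with
  | zero => exact fun x hx => setIntegral_nonneg hS fun t ht => hF t ht x hx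
  | succ n ih =>
    refine ⟨fun x hx => setIntegral_nonneg hS fun t ht => (hF t ht).1 x hx, fun u hu => ?_⟩
    refine congr hadd (ih (F := fun t x => F t x - F t (x + u)) (fun t ht => (hF t ht).2 u hu)
      fun x hx => (hint x hx).sub (hint _ (hadd x hx u hu))) fun x hx => ?_
    exact integral_sub (hint x hx) (hint _ (hadd x hx u hu))

end Group

section Normed

variable {E : Type*} [NormedAddCommGroup E] [NormedSpace ℝ E] {C : Set E}

theorem neg_fderivWithin (hopen : IsOpen C) (hadd : ∀ x ∈ C, ∀ y ∈ C, x + y ∈ C)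
    (hcone : ∀ x ∈ C, ∀ t : ℝ, 0 < t → t • x ∈ C) {n : ℕ} {f : E → ℝ}
    (hf : DifferencesNonneg C (n + 1) f) (hd : DifferentiableOn ℝ f C) {u : E} (hu : u ∈ C) :
    DifferencesNonneg C n (fun x => -fderivWithin ℝ f C x u) := by
  refine of_tendsto (l := 𝓝[>] (0 : ℝ)) hadd
    (F := fun t x => t⁻¹ * (f x - f (x + t • u))) ?_ fun x hx => ?_
  · filter_upwards [self_mem_nhdsWithin] with t ht
    exact (hf.2 _ (hcone u hu t ht)).const_mul (inv_nonneg.2 (le_of_lt ht))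
  · have h := ((hd x hx).hasFDerivWithinAt.hasFDerivAt (hopen.mem_nhds hx)).hasLineDerivAt u
    have h2 := (h.tendsto_slope_zero_right).neg
    refine h2.congr fun t => ?_
    simp only [smul_eq_mul]
    ring

theorem neg_fderivWithin_of_add_smul_mem (hopen : IsOpen C)
    (hadd : ∀ x ∈ C, ∀ y ∈ C, x + y ∈ C)
    (hcone : ∀ x ∈ C, ∀ t : ℝ, 0 < t → t • x ∈ C) {n : ℕ} {f : E → ℝ}
    (hf : DifferencesNonneg C (n + 1) f) (hd : DifferentiableOn ℝ f C) {w p : E}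
    (hw : ∀ t : ℝ, 0 < t → w + t • p ∈ C) :
    DifferencesNonneg C n (fun x => -fderivWithin ℝ f C x w) := by
  refine of_tendsto (l := 𝓝[>] (0 : ℝ)) hadd
    (F := fun t x => -fderivWithin ℝ f C x (w + t • p)) ?_ fun x _ => ?_
  · filter_upwards [self_mem_nhdsWithin] with t ht
    exact neg_fderivWithin hopen hadd hcone hf hd (hw t ht)
  · have : Continuous fun t : ℝ => -fderivWithin ℝ f C x (w + t • p) := by fun_prop
    have h2 := this.tendsto 0
    simp only [zero_smul, add_zero] at h2
    exact h2.mono_left nhdsWithin_le_nhds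

end Normed

end DifferencesNonneg

section Equivalence

variable {E : Type*} [NormedAddCommGroup E] [NormedSpace ℝ E] {C : Set E}

theorem contDiffOn_neg_fderivWithin_apply (hopen : IsOpen C) {f : E → ℝ}
    (hf : ContDiffOn ℝ (⊤ : ℕ∞) f C) (u : E) :
    ContDiffOn ℝ (⊤ : ℕ∞) (fun x => -fderivWithin ℝ f C x u) C :=
  ((hf.fderivWithin hopen.uniqueDiffOn (m := (⊤ : ℕ∞)) (by simp)).clm_apply
    contDiffOn_const).neg

theorem neg_one_pow_mul_iteratedFDerivWithin_succ (hopen : IsOpen C) {f : E → ℝ}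
    (hf : ContDiffOn ℝ (⊤ : ℕ∞) f C) (k : ℕ) (v : Fin (k + 1) → E) {x : E} (hx : x ∈ C) :
    (-1 : ℝ) ^ (k + 1) * iteratedFDerivWithin ℝ (k + 1) f C x v =
      (-1 : ℝ) ^ k * iteratedFDerivWithin ℝ k
        (fun y => -fderivWithin ℝ f C y (v (Fin.last k))) C x (Fin.init v) := by
  have hd : ContDiffOn ℝ (⊤ : ℕ∞) (fderivWithin ℝ f C) C :=
    hf.fderivWithin hopen.uniqueDiffOn (by simp)
  let L : (E →L[ℝ] ℝ) →L[ℝ] ℝ := -(ContinuousLinearMap.apply ℝ ℝ (v (Fin.last k)))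
  have h := L.iteratedFDerivWithin_comp_left (hd x hx) hopen.uniqueDiffOn hx (i := k)
    (by exact_mod_cast le_top)
  have e : (fun y => -fderivWithin ℝ f C y (v (Fin.last k))) = L ∘ fderivWithin ℝ f C := by
    ext y; simp [L]
  rw [e, h, iteratedFDerivWithin_succ_apply_right hopen.uniqueDiffOn hx]
  simp [L, pow_succ]

theorem completelyMonotoneOn_of_differencesNonneg (hopen : IsOpen C)
    (hadd : ∀ x ∈ C, ∀ y ∈ C, x + y ∈ C)
    (hcone : ∀ x ∈ C, ∀ t : ℝ, 0 < t → t • x ∈ C) {f : E → ℝ}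
    (hf : ContDiffOn ℝ (⊤ : ℕ∞) f C) (h : ∀ n, DifferencesNonneg C n f) :
    CompletelyMonotoneOn f C := by
  refine ⟨hf, fun k => ?_⟩
  induction k generalizing f with
  | zero => intro u _ x hx; simpa using h 0 x hx
  | succ k ih =>
    intro u hu x hx
    rw [neg_one_pow_mul_iteratedFDerivWithin_succ hopen hf k u hx]
    exact ih (contDiffOn_neg_fderivWithin_apply hopen hf _)
      (fun n => (h (n + 1)).neg_fderivWithin hopen hadd hcone
        (hf.differentiableOn (by simp)) (hu _)) _ (fun i => hu _) x hx

theorem CompletelyMonotoneOn.neg_fderivWithin (hopen : IsOpen C) {f : E → ℝ}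
    (hf : CompletelyMonotoneOn f C) {u : E} (hu : u ∈ C) :
    CompletelyMonotoneOn (fun x => -fderivWithin ℝ f C x u) C := by
  refine ⟨contDiffOn_neg_fderivWithin_apply hopen hf.1 u, fun k v hv x hx => ?_⟩
  have h := neg_one_pow_mul_iteratedFDerivWithin_succ hopen hf.1 k
    (Fin.snoc (α := fun _ => E) v u) hx
  simp only [Fin.snoc_last, Fin.init_snoc] at h
  rw [← h]
  refine hf.2 _ _ (fun i => ?_) x hx
  refine Fin.lastCases ?_ (fun j => ?_) i
  · simpa using hu
  · simpa using hv j

theorem CompletelyMonotoneOn.differencesNonneg (hopen : IsOpen C)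
    (hadd : ∀ x ∈ C, ∀ y ∈ C, x + y ∈ C)
    (hcone : ∀ x ∈ C, ∀ t : ℝ, 0 < t → t • x ∈ C) {f : E → ℝ}
    (hf : CompletelyMonotoneOn f C) (n : ℕ) : DifferencesNonneg C n f := by
  have hnonneg : ∀ {g : E → ℝ}, CompletelyMonotoneOn g C → ∀ x ∈ C, 0 ≤ g x := by
    intro g hg x hx
    simpa using hg.2 0 (fun _ => x) (fun _ => hx) x hx
  induction n generalizing f with
  | zero => exact hnonneg hf
  | succ n ih =>
    refine ⟨hnonneg hf, fun u hu => ?_⟩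
    have hmem : ∀ x ∈ C, ∀ t ∈ Set.Icc (0 : ℝ) 1, x + t • u ∈ C := by
      intro x hx t ht
      rcases ht.1.eq_or_lt with rfl | h0
      · simpa using hx
      · exact hadd x hx _ (hcone u hu t h0)
    have hcont : ∀ x ∈ C, ContinuousOn
        (fun t : ℝ => -fderivWithin ℝ f C (x + t • u) u) (Set.Icc 0 1) := fun x hx =>
      (hf.neg_fderivWithin hopen hu).1.continuousOn.comp (by fun_prop) (hmem x hx)
    have hI := DifferencesNonneg.setIntegral hadd measurableSet_Ioc (S := Set.Ioc (0 : ℝ) 1)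
      (F := fun t x => -fderivWithin ℝ f C (x + t • u) u)
      (fun t ht => (ih (hf.neg_fderivWithin hopen hu)).comp_add_right
        fun x hx => hmem x hx t ⟨ht.1.le, ht.2⟩)
      (fun x hx => ((hcont x hx).integrableOn_Icc).mono_set Set.Ioc_subset_Icc_self)
    refine hI.congr hadd fun x hx => ?_
    have hderiv : ∀ t ∈ Set.uIcc (0 : ℝ) 1, HasDerivAt (fun t : ℝ => -f (x + t • u))
        (-fderivWithin ℝ f C (x + t • u) u) t := by
      intro t ht
      rw [Set.uIcc_of_le zero_le_one] at ht
      have hm := hmem x hx t ht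
      have h1 := ((hf.1.differentiableOn (by simp) _ hm).hasFDerivWithinAt.hasFDerivAt
        (hopen.mem_nhds hm))
      have h2 : HasDerivAt (fun t : ℝ => x + t • u) u t := by
        simpa using ((hasDerivAt_id t).smul_const u).const_add x
      exact (h1.comp_hasDerivAt t h2).neg
    have h := intervalIntegral.integral_eq_sub_of_hasDerivAt hderiv
      (ContinuousOn.intervalIntegrable (by
        rw [Set.uIcc_of_le zero_le_one]; exact hcont x hx))
    rw [intervalIntegral.integral_of_le zero_le_one] at h
    rw [h]
    simp only [one_smul, zero_smul, add_zero]
    ring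

end Equivalence

section Affine

theorem prod_Ioi_add_mem {V : Type*} [AddCommGroup V] {K : Set V}
    (hadd : ∀ x ∈ K, ∀ y ∈ K, x + y ∈ K) :
    ∀ x ∈ K ×ˢ Set.Ioi (0 : ℝ), ∀ y ∈ K ×ˢ Set.Ioi (0 : ℝ), x + y ∈ K ×ˢ Set.Ioi (0 : ℝ) :=
  fun _ hx _ hy => ⟨hadd _ hx.1 _ hy.1, add_pos (α := ℝ) hx.2 hy.2⟩

variable {V : Type*} [NormedAddCommGroup V] [NormedSpace ℝ V] {K : Set V}

theorem contDiffOn_coeff_of_rpow {β : ℝ} (hβ : 0 < β) {A B : V → ℝ}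
    (hA : ∀ x ∈ K, 0 < A x) (hB : ∀ x ∈ K, 0 < B x)
    (h : ContDiffOn ℝ (⊤ : ℕ∞) (fun p : V × ℝ => (A p.1 + B p.1 * p.2) ^ (-β))
      (K ×ˢ Set.Ioi (0 : ℝ))) :
    ContDiffOn ℝ (⊤ : ℕ∞) (fun p : V × ℝ => A p.1) (K ×ˢ Set.Ioi (0 : ℝ)) ∧
      ContDiffOn ℝ (⊤ : ℕ∞) (fun p : V × ℝ => B p.1) (K ×ˢ Set.Ioi (0 : ℝ)) := by
  have hpos : ∀ p ∈ K ×ˢ Set.Ioi (0 : ℝ), 0 < A p.1 + B p.1 * p.2 := fun p hp =>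
    add_pos (hA _ hp.1) (mul_pos (hB _ hp.1) hp.2)
  have hL : ContDiffOn ℝ (⊤ : ℕ∞) (fun p : V × ℝ => A p.1 + B p.1 * p.2)
      (K ×ˢ Set.Ioi (0 : ℝ)) := by
    refine (h.rpow_const_of_ne (p := -β⁻¹)
      fun p hp => (Real.rpow_pos_of_pos (hpos p hp) _).ne').congr fun p hp => ?_
    rw [← Real.rpow_mul (hpos p hp).le, neg_mul_neg, mul_inv_cancel₀ hβ.ne', Real.rpow_one]
  have hBc : ContDiffOn ℝ (⊤ : ℕ∞) (fun p : V × ℝ => B p.1) (K ×ˢ Set.Ioi (0 : ℝ)) := by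
    have hs : ContDiffOn ℝ (⊤ : ℕ∞) (fun p : V × ℝ => (p.1, p.2 + 1))
      (K ×ˢ Set.Ioi (0 : ℝ)) := by fun_prop
    refine ((hL.comp hs fun p hp => ⟨hp.1, add_pos (α := ℝ) hp.2 one_pos⟩).sub hL).congr
      fun p _ => ?_
    simp only [Function.comp]
    ring
  exact ⟨(hL.sub (hBc.mul contDiffOn_snd)).congr fun p _ => by ring, hBc⟩

theorem prod_Ioi_smul_mem (hcone : ∀ x ∈ K, ∀ t : ℝ, 0 < t → t • x ∈ K) :
    ∀ x ∈ K ×ˢ Set.Ioi (0 : ℝ), ∀ t : ℝ, 0 < t → t • x ∈ K ×ˢ Set.Ioi (0 : ℝ) :=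
  fun _ hx t ht => ⟨hcone _ hx.1 t ht, mul_pos (a := t) ht hx.2⟩

theorem differencesNonneg_pow_mul_rpow (hne : K.Nonempty) (hopen : IsOpen K)
    (hadd : ∀ x ∈ K, ∀ y ∈ K, x + y ∈ K)
    (hcone : ∀ x ∈ K, ∀ t : ℝ, 0 < t → t • x ∈ K)
    {β : ℝ} (hβ : 0 < β) {A B : V → ℝ}
    (hA : ∀ x ∈ K, 0 < A x) (hB : ∀ x ∈ K, 0 < B x)
    (h : CompletelyMonotoneOn (fun p : V × ℝ => (A p.1 + B p.1 * p.2) ^ (-β))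
      (K ×ˢ Set.Ioi (0 : ℝ))) (k n : ℕ) :
    DifferencesNonneg (K ×ˢ Set.Ioi (0 : ℝ)) n
      (fun p => B p.1 ^ k * (A p.1 + B p.1 * p.2) ^ (-β - k)) := by
  have hopen' : IsOpen (K ×ˢ Set.Ioi (0 : ℝ)) := hopen.prod isOpen_Ioi
  have hadd' := prod_Ioi_add_mem hadd
  have hcone' := prod_Ioi_smul_mem hcone
  obtain ⟨hAc, hBc⟩ := contDiffOn_coeff_of_rpow hβ hA hB h.1
  have hpos : ∀ p ∈ K ×ˢ Set.Ioi (0 : ℝ), 0 < A p.1 + B p.1 * p.2 := fun p hp =>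
    add_pos (hA _ hp.1) (mul_pos (hB _ hp.1) hp.2)
  induction k generalizing n with
  | zero => simpa using h.differencesNonneg hopen' hadd' hcone' n
  | succ k ih =>
    have hd : ContDiffOn ℝ (⊤ : ℕ∞)
        (fun p : V × ℝ => B p.1 ^ k * (A p.1 + B p.1 * p.2) ^ (-β - k))
        (K ×ˢ Set.Ioi (0 : ℝ)) :=
      (hBc.pow k).mul ((hAc.add (hBc.mul contDiffOn_snd)).rpow_const_of_ne
        fun p hp => (hpos p hp).ne')
    have hdiff := hd.differentiableOn (by simp)
    obtain ⟨v, hv⟩ := hne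
    have hβk : 0 < β + k := by positivity
    have hstep := ((ih (n + 1)).neg_fderivWithin_of_add_smul_mem hopen' hadd' hcone' hdiff
      (w := ((0 : V), (1 : ℝ))) (p := (v, 1)) fun t ht =>
        ⟨by simpa using hcone v hv t ht, by simpa using add_pos one_pos ht⟩).const_mul
      (inv_nonneg.2 hβk.le)
    refine hstep.congr hadd' fun p hp => ?_
    have h1 := ((hdiff p hp).hasFDerivWithinAt.hasFDerivAt
      (hopen'.mem_nhds hp)).hasLineDerivAt ((0 : V), (1 : ℝ))
    have h2 : HasLineDerivAt ℝ
        (fun p : V × ℝ => B p.1 ^ k * (A p.1 + B p.1 * p.2) ^ (-β - k))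
        (B p.1 ^ k * (B p.1 * (-β - k) * (A p.1 + B p.1 * p.2) ^ (-β - k - 1)))
        p ((0 : V), (1 : ℝ)) := by
      have hlin : HasDerivAt (fun t : ℝ => A p.1 + B p.1 * (p.2 + t)) (B p.1) 0 := by
        simpa using (((hasDerivAt_id (0 : ℝ)).const_add p.2).const_mul (B p.1)).const_add (A p.1)
      have := (hlin.rpow_const (p := -β - k)
        (Or.inl (by simpa using (hpos p hp).ne'))).const_mul (B p.1 ^ k)
      simpa [HasLineDerivAt] using this
    rw [h1.unique h2]
    push_cast
    rw [← sub_sub]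
    field_simp
    ring

theorem differencesNonneg_rpow_mul_exp (hne : K.Nonempty) (hopen : IsOpen K)
    (hadd : ∀ x ∈ K, ∀ y ∈ K, x + y ∈ K)
    (hcone : ∀ x ∈ K, ∀ t : ℝ, 0 < t → t • x ∈ K)
    {β : ℝ} (hβ : 0 < β) {A B : V → ℝ}
    (hA : ∀ x ∈ K, 0 < A x) (hB : ∀ x ∈ K, 0 < B x)
    (h : CompletelyMonotoneOn (fun p : V × ℝ => (A p.1 + B p.1 * p.2) ^ (-β))
      (K ×ˢ Set.Ioi (0 : ℝ))) {t : ℝ} (ht : 0 < t) (n : ℕ) :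
    DifferencesNonneg (K ×ˢ Set.Ioi (0 : ℝ)) n
      (fun p => B p.1 ^ (-β) * Real.exp (-(t * (A p.1 / B p.1 + p.2 / 2)))) := by
  refine DifferencesNonneg.of_tendsto (l := atTop) (prod_Ioi_add_mem hadd)
    (F := fun (k : ℕ) (p : V × ℝ) => (k / t) ^ (β + k) *
      (B p.1 ^ k * (A p.1 + B p.1 * (p.2 / 2 + k / t)) ^ (-β - k))) ?_ fun p hp => ?_
  · refine Eventually.of_forall fun k => ?_
    refine DifferencesNonneg.const_mul (by positivity) ?_
    have hT : ∀ p ∈ K ×ˢ Set.Ioi (0 : ℝ), (p.1, p.2 / 2 + k / t) ∈ K ×ˢ Set.Ioi (0 : ℝ) :=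
      fun p hp => ⟨hp.1, add_pos_of_pos_of_nonneg (half_pos (α := ℝ) hp.2) (by positivity)⟩
    have hL : ∀ p ∈ K ×ˢ Set.Ioi (0 : ℝ), (p.1, p.2 / 2) ∈ K ×ˢ Set.Ioi (0 : ℝ) :=
      fun p hp => ⟨hp.1, half_pos (α := ℝ) hp.2⟩
    refine (differencesNonneg_pow_mul_rpow hne hopen hadd hcone hβ hA hB h k n).comp_affine
      hT hL fun x u => ?_
    ext
    · simp
    · simp only [Prod.snd_add]; ring
  · have hBp := hB _ hp.1
    have hAp := hA _ hp.1
    have hy : 0 < p.2 := hp.2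
    set c := A p.1 / B p.1 + p.2 / 2 with hc
    have hcpos : 0 < c := by positivity
    have hlim1 : Tendsto (fun k : ℕ => (1 + t * c / k) ^ (-β)) atTop (𝓝 1) := by
      have : Tendsto (fun k : ℕ => 1 + t * c / k) atTop (𝓝 1) := by
        simpa using (tendsto_const_div_atTop_nhds_zero_nat (t * c)).const_add 1
      simpa using this.rpow_const (p := -β) (Or.inl one_ne_zero)
    have hlim2 := (Real.tendsto_one_add_div_pow_exp (t * c)).inv₀ (Real.exp_ne_zero _)
    have hlim := (hlim1.mul hlim2).const_mul (B p.1 ^ (-β))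
    rw [one_mul, ← Real.exp_neg] at hlim
    refine hlim.congr' ?_
    filter_upwards [eventually_gt_atTop 0] with k hk
    have hk' : (0 : ℝ) < k := by exact_mod_cast hk
    have hkt : 0 < (k : ℝ) / t := by positivity
    have hfac : A p.1 + B p.1 * (p.2 / 2 + k / t) = B p.1 * (k / t * (1 + t * c / k)) := by
      rw [hc]; field_simp; ring
    have h1 : 0 < 1 + t * c / k := by positivity
    rw [hfac, Real.mul_rpow hBp.le (by positivity), Real.mul_rpow hkt.le h1.le,
      show -β - (k : ℝ) = -(β + k) by ring, Real.rpow_neg hkt.le,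
      show -(β + (k : ℝ)) = -β - k by ring, Real.rpow_sub hBp, Real.rpow_sub h1,
      Real.rpow_natCast, Real.rpow_natCast]
    have h3 : ((k : ℝ) / t) ^ (β + k) ≠ 0 := (Real.rpow_pos_of_pos hkt _).ne'
    have h4 : B p.1 ^ k ≠ 0 := by positivity
    field_simp

end Affine

/-- analytic parallel connection.  Let `K` be an open convex cone in a
finite-dimensional real vector space `V`, `β > 0`, and `A, B, C', D : K → (0,∞)`.  If
`(A+By)^{-β}` and `(C'+Dy)^{-β}` are completely monotone on `K × (0,∞)`, then so is
`(AD+BC'+BDy)^{-β}`. -/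
theorem completely_monotone_parallel_connection
    {V : Type*} [NormedAddCommGroup V] [NormedSpace ℝ V] [FiniteDimensional ℝ V]
    (K : Set V) (hne : K.Nonempty) (hopen : IsOpen K) (hconv : Convex ℝ K)
    (hcone : ∀ x ∈ K, ∀ t : ℝ, 0 < t → t • x ∈ K)
    (β : ℝ) (hβ : 0 < β)
    (A B C' D : V → ℝ)
    (hA : ∀ x ∈ K, 0 < A x) (hB : ∀ x ∈ K, 0 < B x)
    (hC' : ∀ x ∈ K, 0 < C' x) (hD : ∀ x ∈ K, 0 < D x)
    (h1 : CompletelyMonotoneOn (fun p : V × ℝ => (A p.1 + B p.1 * p.2) ^ (-β))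
            (K ×ˢ Set.Ioi (0 : ℝ)))
    (h2 : CompletelyMonotoneOn (fun p : V × ℝ => (C' p.1 + D p.1 * p.2) ^ (-β))
            (K ×ˢ Set.Ioi (0 : ℝ))) :
    CompletelyMonotoneOn
      (fun p : V × ℝ =>
        (A p.1 * D p.1 + B p.1 * C' p.1 + B p.1 * D p.1 * p.2) ^ (-β))
      (K ×ˢ Set.Ioi (0 : ℝ)) := by
  have hadd : ∀ x ∈ K, ∀ y ∈ K, x + y ∈ K := fun x hx y hy => by
    have h := hcone _ (hconv hx hy (a := 1 / 2) (b := 1 / 2) (by norm_num) (by norm_num)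
      (by norm_num)) 2 (by norm_num)
    simpa [smul_smul] using h
  have hadd' := prod_Ioi_add_mem hadd
  obtain ⟨hAc, hBc⟩ := contDiffOn_coeff_of_rpow hβ hA hB h1.1
  obtain ⟨hCc, hDc⟩ := contDiffOn_coeff_of_rpow hβ hC' hD h2.1
  refine completelyMonotoneOn_of_differencesNonneg (hopen.prod isOpen_Ioi) hadd'
    (prod_Ioi_smul_mem hcone) ?_ fun n => ?_
  · refine (((hAc.mul hDc).add (hBc.mul hCc)).add
      ((hBc.mul hDc).mul contDiffOn_snd)).rpow_const_of_ne fun p hp => ?_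
    have := hA _ hp.1
    have := hB _ hp.1
    have := hC' _ hp.1
    have := hD _ hp.1
    have : 0 < p.2 := hp.2
    positivity
  · have hrepr : ∀ p ∈ K ×ˢ Set.Ioi (0 : ℝ),
        0 < A p.1 / B p.1 + C' p.1 / D p.1 + p.2 := fun p hp =>
      add_pos (add_pos (div_pos (hA _ hp.1) (hB _ hp.1)) (div_pos (hC' _ hp.1) (hD _ hp.1))) hp.2
    have hprod : ∀ t (p : V × ℝ),
        t ^ (β - 1) * ((B p.1 ^ (-β) * Real.exp (-(t * (A p.1 / B p.1 + p.2 / 2)))) *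
          (D p.1 ^ (-β) * Real.exp (-(t * (C' p.1 / D p.1 + p.2 / 2))))) =
        (B p.1 ^ (-β) * D p.1 ^ (-β)) *
          (t ^ (β - 1) * Real.exp (-((A p.1 / B p.1 + C' p.1 / D p.1 + p.2) * t))) := by
      intro t p
      rw [show -((A p.1 / B p.1 + C' p.1 / D p.1 + p.2) * t) =
        -(t * (A p.1 / B p.1 + p.2 / 2)) + -(t * (C' p.1 / D p.1 + p.2 / 2)) by ring,
        Real.exp_add]
      ring
    have hI := (DifferencesNonneg.setIntegral hadd' (S := Set.Ioi (0 : ℝ)) measurableSet_Ioi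
      (n := n)
      (F := fun t p =>
        t ^ (β - 1) * ((B p.1 ^ (-β) * Real.exp (-(t * (A p.1 / B p.1 + p.2 / 2)))) *
          (D p.1 ^ (-β) * Real.exp (-(t * (C' p.1 / D p.1 + p.2 / 2))))))
      (fun t ht => ((differencesNonneg_rpow_mul_exp hne hopen hadd hcone hβ hA hB h1 ht n).mul
        hadd' (differencesNonneg_rpow_mul_exp hne hopen hadd hcone hβ hC' hD h2 ht n)).const_mul
          (Real.rpow_nonneg (le_of_lt ht) _))
      (fun p hp => by
        simp only [hprod]
        have := integrableOn_rpow_mul_exp_neg_mul_rpow (s := β - 1) (p := 1) (by linarith)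
          one_pos (hrepr p hp)
        simp only [Real.rpow_one, neg_mul] at this
        exact this.const_mul _)).const_mul
      (inv_nonneg.2 (Real.Gamma_pos_of_pos hβ).le)
    refine hI.congr hadd' fun p hp => ?_
    have hBp := hB _ hp.1
    have hDp := hD _ hp.1
    have hs := hrepr p hp
    simp only [hprod]
    rw [integral_const_mul, Real.integral_rpow_mul_exp_neg_mul_Ioi hβ hs,
      show A p.1 * D p.1 + B p.1 * C' p.1 + B p.1 * D p.1 * p.2 =
        B p.1 * D p.1 * (A p.1 / B p.1 + C' p.1 / D p.1 + p.2) by field_simp,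
      Real.mul_rpow (by positivity) hs.le, Real.mul_rpow hBp.le hDp.le, one_div,
      Real.inv_rpow hs.le, Real.rpow_neg hs.le]
    have := (Real.Gamma_pos_of_pos hβ).ne'
    field_simp
end

section
/- Fix a real number β and a real λ > 0, and define F(u,v) = (u+v)^{-β} exp(−λ uv/(u+v)) for u, v > 0. Then F is completely monotone on (0,∞)^2 if and only if β ≥ 1/2. -/
/-- The open positive orthant `(0,∞)^ι`. -/
def posOrthant (ι : Type*) : Set (ι → ℝ) := {x | ∀ i, 0 < x i}

/-- A function `f : (0,∞)^ι → ℝ` is completely monotone if it is `C^∞` on the open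
orthant and `(−1)^k ∂^k f/(∂x_{i_1}···∂x_{i_k}) ≥ 0` there, for every `k ≥ 0` and all
indices `i_1, …, i_k`. -/
def CompletelyMonotoneOnOrthant {ι : Type*} [Fintype ι] [DecidableEq ι]
    (f : (ι → ℝ) → ℝ) : Prop :=
  ContDiffOn ℝ (⊤ : ℕ∞) f (posOrthant ι) ∧
    ∀ (k : ℕ) (idx : Fin k → ι), ∀ x ∈ posOrthant ι,
      0 ≤ (-1 : ℝ) ^ k *
        iteratedFDerivWithin ℝ k f (posOrthant ι) x (fun j => Pi.single (idx j) (1 : ℝ))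


open Filter Topology MeasureTheory

section General

variable {ι : Type*} [Fintype ι]

theorem isOpen_posOrthant : IsOpen (posOrthant ι) := by
  have h : posOrthant ι = Set.univ.pi fun _ => Set.Ioi (0 : ℝ) := by
    ext x; simp [posOrthant]
  rw [h]
  exact isOpen_set_pi Set.finite_univ fun _ _ => isOpen_Ioi

/-- `g` is the negative gradient of `f` on the open orthant. -/
def IsNegGradOnOrthant (f : (ι → ℝ) → ℝ) (g : ι → (ι → ℝ) → ℝ) : Prop :=
  ∀ x ∈ posOrthant ι,
    HasFDerivAt f (∑ i, (-(g i x)) • ContinuousLinearMap.proj (R := ℝ) (φ := fun _ : ι => ℝ) i) x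

theorem integrable_sum_smul_const {Ω V : Type*} [MeasurableSpace Ω] {μ : Measure Ω}
    [NormedAddCommGroup V] [NormedSpace ℝ V] {c : ι → Ω → ℝ} (hc : ∀ i, Integrable (c i) μ)
    (v : ι → V) : Integrable (fun t => ∑ i, c i t • v i) μ :=
  integrable_finsetSum _ fun i _ => (hc i).smul_const (v i)

theorem integral_sum_smul_const {Ω V : Type*} [MeasurableSpace Ω] {μ : Measure Ω}
    [NormedAddCommGroup V] [NormedSpace ℝ V] [CompleteSpace V] {c : ι → Ω → ℝ}
    (hc : ∀ i, Integrable (c i) μ) (v : ι → V) :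
    ∫ t, ∑ i, c i t • v i ∂μ = ∑ i, (∫ t, c i t ∂μ) • v i := by
  rw [integral_finsetSum _ fun i _ => (hc i).smul_const (v i)]
  simp only [integral_smul_const]

variable [DecidableEq ι]

theorem IsNegGradOnOrthant.fderivWithin_single {f : (ι → ℝ) → ℝ} {g : ι → (ι → ℝ) → ℝ}
    (h : IsNegGradOnOrthant f g) {x : ι → ℝ} (hx : x ∈ posOrthant ι) (i : ι) :
    fderivWithin ℝ f (posOrthant ι) x (Pi.single i 1) = -(g i x) := by
  rw [fderivWithin_of_isOpen isOpen_posOrthant hx, (h x hx).fderiv]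
  simp [Pi.single_apply]

theorem isNegGradOnOrthant_of_differentiableOn {f : (ι → ℝ) → ℝ}
    (h : DifferentiableOn ℝ f (posOrthant ι)) :
    IsNegGradOnOrthant f
      fun i x => -(fderivWithin ℝ f (posOrthant ι) x (Pi.single i 1)) := by
  intro x hx
  have hd := (h.differentiableAt (isOpen_posOrthant.mem_nhds hx)).hasFDerivAt
  refine hd.congr_fderiv (ContinuousLinearMap.ext fun y => ?_)
  simp only [fderivWithin_of_isOpen isOpen_posOrthant hx]
  conv_lhs => rw [pi_eq_sum_univ' y]
  simp [mul_comm]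

theorem iteratedFDerivWithin_succ_single {f : (ι → ℝ) → ℝ}
    (hf : ContDiffOn ℝ (⊤ : ℕ∞) f (posOrthant ι)) {x : ι → ℝ} (hx : x ∈ posOrthant ι)
    {k : ℕ} (idx : Fin (k + 1) → ι) :
    iteratedFDerivWithin ℝ (k + 1) f (posOrthant ι) x (fun j => Pi.single (idx j) (1 : ℝ)) =
      iteratedFDerivWithin ℝ k
        (fun y => fderivWithin ℝ f (posOrthant ι) y (Pi.single (idx (Fin.last k)) 1))
        (posOrthant ι) x (fun j => Pi.single (idx j.castSucc) (1 : ℝ)) := by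
  have hu := (isOpen_posOrthant (ι := ι)).uniqueDiffOn (𝕜 := ℝ)
  rw [iteratedFDerivWithin_succ_apply_right hu hx]
  have hd : ContDiffOn ℝ (⊤ : ℕ∞) (fun y => fderivWithin ℝ f (posOrthant ι) y) (posOrthant ι) :=
    hf.fderivWithin hu (by simp)
  have := ContinuousLinearMap.iteratedFDerivWithin_comp_left (i := k)
    (ContinuousLinearMap.apply ℝ ℝ (Pi.single (idx (Fin.last k)) 1 : ι → ℝ)) (hd x hx) hu hx
    (by exact_mod_cast le_top)
  have h2 := DFunLike.congr_fun this (fun j : Fin k => (Pi.single (idx j.castSucc) (1 : ℝ) : ι → ℝ))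
  simp only [ContinuousLinearMap.compContinuousMultilinearMap_coe, Function.comp_def,
    ContinuousLinearMap.apply_apply] at h2
  rw [h2]
  rfl

/-- Complete monotonicity by coinduction. -/
theorem completelyMonotoneOnOrthant_of_coinduction (P : ((ι → ℝ) → ℝ) → Prop)
    (hnonneg : ∀ f, P f → ∀ x ∈ posOrthant ι, 0 ≤ f x)
    (hgrad : ∀ f, P f → ∃ g, (∀ i, P (g i)) ∧ IsNegGradOnOrthant f g)
    {f : (ι → ℝ) → ℝ} (hf : P f) : CompletelyMonotoneOnOrthant f := by
  have hsmooth : ∀ f, P f → ContDiffOn ℝ (⊤ : ℕ∞) f (posOrthant ι) := by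
    intro f hf
    refine contDiffOn_infty.2 fun n => ?_
    induction n generalizing f with
    | zero =>
      obtain ⟨g, -, hg⟩ := hgrad f hf
      exact contDiffOn_zero.2 fun x hx => (hg x hx).continuousAt.continuousWithinAt
    | succ n ih =>
      obtain ⟨g, hP, hg⟩ := hgrad f hf
      push_cast
      rw [contDiffOn_succ_iff_fderiv_of_isOpen isOpen_posOrthant]
      refine ⟨fun x hx => (hg x hx).differentiableAt.differentiableWithinAt, by simp, ?_⟩
      refine ContDiffOn.congr (f := fun x => ∑ i, (-(g i x)) •
        ContinuousLinearMap.proj (R := ℝ) (φ := fun _ : ι => ℝ) i) ?_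
        fun x hx => (hg x hx).fderiv
      exact ContDiffOn.sum fun i _ => (ih _ (hP i)).neg.smul contDiffOn_const
  refine ⟨hsmooth f hf, fun k => ?_⟩
  induction k generalizing f with
  | zero => intro idx x hx; simpa using hnonneg f hf x hx
  | succ k ih =>
    intro idx x hx
    obtain ⟨g, hP, hg⟩ := hgrad f hf
    rw [iteratedFDerivWithin_succ_single (hsmooth f hf) hx,
      iteratedFDerivWithin_congr (f := -(g (idx (Fin.last k))))
        (fun y hy => hg.fderivWithin_single hy _) hx,
      iteratedFDerivWithin_neg_apply isOpen_posOrthant.uniqueDiffOn hx]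
    have := ih (hP (idx (Fin.last k))) (fun j => idx j.castSucc) x hx
    rw [pow_succ]
    simpa using this

namespace CompletelyMonotoneOnOrthant

theorem nonneg {f : (ι → ℝ) → ℝ} (hf : CompletelyMonotoneOnOrthant f) {x : ι → ℝ}
    (hx : x ∈ posOrthant ι) : 0 ≤ f x := by
  simpa using hf.2 0 Fin.elim0 x hx

theorem exists_negGrad {f : (ι → ℝ) → ℝ} (hf : CompletelyMonotoneOnOrthant f) :
    ∃ g, (∀ i, CompletelyMonotoneOnOrthant (g i)) ∧ IsNegGradOnOrthant f g := by
  have hu := (isOpen_posOrthant (ι := ι)).uniqueDiffOn (𝕜 := ℝ)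
  refine ⟨_, fun i => ⟨?_, fun k idx x hx => ?_⟩,
    isNegGradOnOrthant_of_differentiableOn (hf.1.differentiableOn (by simp))⟩
  · exact ((hf.1.fderivWithin hu (m := (⊤ : ℕ∞)) (by simp)).clm_apply contDiffOn_const).neg
  · have h := hf.2 (k + 1) (Fin.snoc idx i) x hx
    rw [iteratedFDerivWithin_succ_single hf.1 hx] at h
    simp only [Fin.snoc_last, Fin.snoc_castSucc] at h
    change 0 ≤ _ * iteratedFDerivWithin ℝ k
      (-(fun y => fderivWithin ℝ f (posOrthant ι) y (Pi.single i 1))) (posOrthant ι) x _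
    rw [iteratedFDerivWithin_neg_apply hu hx]
    rw [pow_succ] at h
    simpa using h

theorem congr {f g : (ι → ℝ) → ℝ} (hf : CompletelyMonotoneOnOrthant f)
    (h : Set.EqOn g f (posOrthant ι)) : CompletelyMonotoneOnOrthant g := by
  refine ⟨hf.1.congr h, fun k idx x hx => ?_⟩
  rw [iteratedFDerivWithin_congr h hx]
  exact hf.2 k idx x hx

theorem mul {f g : (ι → ℝ) → ℝ} (hf : CompletelyMonotoneOnOrthant f)
    (hg : CompletelyMonotoneOnOrthant g) : CompletelyMonotoneOnOrthant (f * g) := by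
  let S : Set ((ι → ℝ) → ℝ) :=
    {h | ∃ f g, CompletelyMonotoneOnOrthant f ∧ CompletelyMonotoneOnOrthant g ∧ h = f * g}
  refine completelyMonotoneOnOrthant_of_coinduction (· ∈ AddSubmonoid.closure S) ?_ ?_
    (AddSubmonoid.subset_closure ⟨f, g, hf, hg, rfl⟩)
  · intro h hh x hx
    induction hh using AddSubmonoid.closure_induction with
    | mem h hS =>
      obtain ⟨f, g, hf, hg, rfl⟩ := hS
      exact mul_nonneg (hf.nonneg hx) (hg.nonneg hx)
    | zero => simp
    | add a b _ _ ha hb => exact add_nonneg ha hb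
  · intro h hh
    induction hh using AddSubmonoid.closure_induction with
    | mem h hS =>
      obtain ⟨f, g, hf, hg, rfl⟩ := hS
      obtain ⟨f', hf', hdf⟩ := hf.exists_negGrad
      obtain ⟨g', hg', hdg⟩ := hg.exists_negGrad
      refine ⟨fun i => f' i * g + f * g' i, fun i => add_mem
        (AddSubmonoid.subset_closure ⟨_, _, hf' i, hg, rfl⟩)
        (AddSubmonoid.subset_closure ⟨_, _, hf, hg' i, rfl⟩), fun x hx => ?_⟩
      refine ((hdf x hx).mul (hdg x hx)).congr_fderiv ?_
      ext y
      simp only [add_apply, smul_apply, sum_apply, Finset.smul_sum, ContinuousLinearMap.proj_apply,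
        smul_eq_mul, Pi.add_apply, Pi.mul_apply, ← Finset.sum_add_distrib]
      exact Finset.sum_congr rfl fun i _ => by ring
    | zero =>
      refine ⟨fun _ => 0, fun _ => zero_mem _, fun x _ => ?_⟩
      exact (hasFDerivAt_const (0 : ℝ) x).congr_fderiv (by simp)
    | add a b _ _ ha hb =>
      obtain ⟨a', ha', hda⟩ := ha
      obtain ⟨b', hb', hdb⟩ := hb
      refine ⟨fun i => a' i + b' i, fun i => add_mem (ha' i) (hb' i), fun x hx => ?_⟩
      refine ((hda x hx).add (hdb x hx)).congr_fderiv ?_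
      simp only [← Finset.sum_add_distrib, ← add_smul, Pi.add_apply, neg_add]

end CompletelyMonotoneOnOrthant

/-- A weighted mixture of exponentials `x ↦ exp (-∑ i, x i * a i t)` with nonnegative rates is
completely monotone. -/
theorem completelyMonotoneOnOrthant_integral_exp {Ω : Type*} [MeasurableSpace Ω] {μ : Measure Ω}
    {a : ι → Ω → ℝ} (ha : ∀ i, Measurable (a i)) (ha0 : ∀ i t, 0 ≤ a i t)
    (hexp_int : ∀ x ∈ posOrthant ι, Integrable (fun t => Real.exp (-∑ i, x i * a i t)) μ) :
    CompletelyMonotoneOnOrthant fun x => ∫ t, Real.exp (-∑ i, x i * a i t) ∂μ := by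
  let E : (ι → ℝ) → Ω → ℝ := fun x t => Real.exp (-∑ i, x i * a i t)
  let P : ((ι → ℝ) → ℝ) → Prop := fun f => ∃ w : Ω → ℝ, Measurable w ∧ (∀ t, 0 ≤ w t) ∧
    (∀ x ∈ posOrthant ι, Integrable (fun t => w t * E x t) μ) ∧
    f = fun x => ∫ t, w t * E x t ∂μ
  refine completelyMonotoneOnOrthant_of_coinduction P ?_ ?_
    ⟨fun _ => 1, measurable_const, fun _ => zero_le_one, by simpa [E] using hexp_int, by simp [E]⟩
  · rintro f ⟨w, -, hw0, -, rfl⟩ x -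
    exact integral_nonneg fun t => mul_nonneg (hw0 t) (Real.exp_pos _).le
  · rintro f ⟨w, hwm, hw0, hwi, rfl⟩
    have hEm : ∀ x, Measurable (E x) := fun x =>
      (Finset.measurable_sum _ fun i _ => (ha i).const_mul (x i)).neg.exp
    have hmono : ∀ x y : ι → ℝ, (∀ i, x i ≤ y i) → ∀ t, E y t ≤ E x t := fun x y hxy t =>
      Real.exp_le_exp.2 (neg_le_neg (Finset.sum_le_sum fun i _ =>
        mul_le_mul_of_nonneg_right (hxy i) (ha0 i t)))
    have hhalf : ∀ x ∈ posOrthant ι, (2⁻¹ : ℝ) • x ∈ posOrthant ι := fun x hx i => by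
      simpa using hx i
    have hbd : ∀ x ∈ posOrthant ι, ∀ i t,
        a i t * E x t ≤ (2 / x i) * E ((2⁻¹ : ℝ) • x) t := by
      intro x hx i t
      have hxi := hx i
      have h1 : x i / 2 * a i t ≤ Real.exp (∑ j, x j / 2 * a j t) := by
        refine le_trans ?_ (Real.add_one_le_exp _)
        have := Finset.single_le_sum (f := fun j => x j / 2 * a j t)
          (fun j _ => mul_nonneg (by linarith [hx j]) (ha0 j t)) (Finset.mem_univ i)
        linarith
      have h2 : E x t = Real.exp (-∑ j, x j / 2 * a j t) * E ((2⁻¹ : ℝ) • x) t := by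
        simp only [E, ← Real.exp_add, ← neg_add, ← Finset.sum_add_distrib]
        congr 2
        exact Finset.sum_congr rfl fun j _ => by simp; ring
      have h3 : a i t * Real.exp (-∑ j, x j / 2 * a j t) ≤ 2 / x i := by
        rw [Real.exp_neg, ← div_eq_mul_inv, div_le_div_iff₀ (Real.exp_pos _) hxi]
        linarith
      rw [h2, ← mul_assoc]
      exact mul_le_mul_of_nonneg_right h3 (Real.exp_pos _).le
    have hwai : ∀ i, ∀ x ∈ posOrthant ι, Integrable (fun t => (w t * a i t) * E x t) μ := by
      intro i x hx
      refine ((hwi _ (hhalf x hx)).const_mul (2 / x i)).mono'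
        ((hwm.mul (ha i)).mul (hEm x)).aestronglyMeasurable (ae_of_all _ fun t => ?_)
      rw [Real.norm_of_nonneg
        (mul_nonneg (mul_nonneg (hw0 t) (ha0 i t)) (Real.exp_pos _).le)]
      have := mul_le_mul_of_nonneg_left (hbd x hx i t) (hw0 t)
      linarith
    refine ⟨fun i x => ∫ t, (w t * a i t) * E x t ∂μ, fun i => ⟨_, hwm.mul (ha i),
      fun t => mul_nonneg (hw0 t) (ha0 i t), hwai i, rfl⟩, fun x₀ hx₀ => ?_⟩
    let pr : ι → (ι → ℝ) →L[ℝ] ℝ := fun i => ContinuousLinearMap.proj i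
    let F' : (ι → ℝ) → Ω → (ι → ℝ) →L[ℝ] ℝ := fun x t =>
      ∑ i, (-((w t * a i t) * E x t)) • pr i
    let s : Set (ι → ℝ) := {x | ∀ i, x₀ i / 2 < x i}
    have hs : s ∈ 𝓝 x₀ := by
      have : s = Set.univ.pi fun i => Set.Ioi (x₀ i / 2) := by ext x; simp [s]
      rw [this]
      refine (isOpen_set_pi Set.finite_univ fun _ _ => isOpen_Ioi).mem_nhds fun i _ => ?_
      have := hx₀ i
      simp only [Set.mem_Ioi]; linarith
    have key := hasFDerivAt_integral_of_dominated_of_fderiv_le (μ := μ) (𝕜 := ℝ)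
      (F := fun x t => w t * E x t) (F' := F') (x₀ := x₀) (s := s)
      (bound := fun t => ∑ i, ((w t * a i t) * E ((2⁻¹ : ℝ) • x₀) t) * ‖pr i‖)
      hs (Eventually.of_forall fun x => (hwm.mul (hEm x)).aestronglyMeasurable) (hwi x₀ hx₀)
      ?_ ?_ ?_ ?_
    · refine key.congr_fderiv ?_
      exact (integral_sum_smul_const (fun i => (hwai i x₀ hx₀).neg) pr).trans
        (Finset.sum_congr rfl fun i _ => congrArg (· • pr i) (integral_neg _))
    · exact (integrable_sum_smul_const (fun i => (hwai i x₀ hx₀).neg) pr).aestronglyMeasurable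
    · refine ae_of_all _ fun t x hx => (norm_sum_le _ _).trans (Finset.sum_le_sum fun i _ => ?_)
      have h0 := mul_nonneg (hw0 t) (ha0 i t)
      rw [norm_smul, norm_neg, Real.norm_of_nonneg (mul_nonneg h0 (Real.exp_pos _).le)]
      refine mul_le_mul_of_nonneg_right (mul_le_mul_of_nonneg_left (hmono _ _ (fun j => ?_) t) h0)
        (norm_nonneg _)
      have := hx j
      simp only [Pi.smul_apply, smul_eq_mul]; linarith
    · exact integrable_finsetSum _ fun i _ => (hwai i _ (hhalf x₀ hx₀)).mul_const _
    · refine ae_of_all _ fun t x _ => ?_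
      have h1 : HasFDerivAt (fun x : ι → ℝ => -∑ i, x i * a i t) (-∑ i, a i t • pr i) x :=
        (HasFDerivAt.fun_sum fun i _ =>
          ((ContinuousLinearMap.proj (R := ℝ) (φ := fun _ : ι => ℝ) i).hasFDerivAt
            (x := x)).mul_const (a i t)).neg
      refine (h1.exp.const_mul (w t)).congr_fderiv ?_
      simp only [F', E, smul_neg, Finset.smul_sum, smul_smul]
      rw [← Finset.sum_neg_distrib]
      refine Finset.sum_congr rfl fun i _ => ?_
      rw [← neg_smul]
      congr 1
      ring

end General

section Kernel

theorem sum_pos_of_mem_posOrthant {x : Fin 2 → ℝ} (hx : x ∈ posOrthant (Fin 2)) :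
    0 < x 0 + x 1 := add_pos (hx 0) (hx 1)

theorem completelyMonotoneOnOrthant_const_mul_rpow {c γ : ℝ} (hc : 0 ≤ c) (hγ : 0 ≤ γ) :
    CompletelyMonotoneOnOrthant fun x : Fin 2 → ℝ => c * (x 0 + x 1) ^ (-γ) := by
  refine completelyMonotoneOnOrthant_of_coinduction
    (fun f => ∃ c γ : ℝ, 0 ≤ c ∧ 0 ≤ γ ∧ f = fun x : Fin 2 → ℝ => c * (x 0 + x 1) ^ (-γ))
    ?_ ?_ ⟨c, γ, hc, hγ, rfl⟩
  · rintro f ⟨c, γ, hc, -, rfl⟩ x hx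
    exact mul_nonneg hc (Real.rpow_nonneg (sum_pos_of_mem_posOrthant hx).le _)
  · rintro f ⟨c, γ, hc, hγ, rfl⟩
    refine ⟨fun _ x => (c * γ) * (x 0 + x 1) ^ (-(γ + 1)), fun _ =>
      ⟨_, _, mul_nonneg hc hγ, by linarith, rfl⟩, fun x hx => ?_⟩
    have h1 : HasFDerivAt (fun x : Fin 2 → ℝ => x 0 + x 1) _ x :=
      ((ContinuousLinearMap.proj (R := ℝ) (φ := fun _ : Fin 2 => ℝ) 0).hasFDerivAt (x := x)).add
        (ContinuousLinearMap.proj (R := ℝ) (φ := fun _ : Fin 2 => ℝ) 1).hasFDerivAt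
    refine ((h1.rpow_const (p := -γ)
      (Or.inl (sum_pos_of_mem_posOrthant hx).ne')).const_mul c).congr_fderiv ?_
    have he : -(γ + 1) = -γ - 1 := by ring
    ext y
    simp [he]
    ring

theorem gaussian_exponent_eq (lam u v t : ℝ) (h : u + v ≠ 0) :
    -(u * (lam * t ^ 2) + v * (lam * (1 - t) ^ 2)) =
      -(lam * (u * v) / (u + v)) + -(lam * (u + v)) * (t - v / (u + v)) ^ 2 := by
  field_simp
  ring

theorem completelyMonotoneOnOrthant_kernel {β lam : ℝ} (hlam : 0 < lam) (hβ : 1 / 2 ≤ β) :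
    CompletelyMonotoneOnOrthant fun x : Fin 2 → ℝ =>
      (x 0 + x 1) ^ (-β) * Real.exp (-(lam * (x 0 * x 1) / (x 0 + x 1))) := by
  let a : Fin 2 → ℝ → ℝ := ![fun t => lam * t ^ 2, fun t => lam * (1 - t) ^ 2]
  have hexp : ∀ x ∈ posOrthant (Fin 2), (fun t => Real.exp (-∑ i, x i * a i t)) = fun t =>
      Real.exp (-(lam * (x 0 * x 1) / (x 0 + x 1))) *
        Real.exp (-(lam * (x 0 + x 1)) * (t - x 1 / (x 0 + x 1)) ^ 2) := by
    intro x hx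
    funext t
    rw [← Real.exp_add, ← gaussian_exponent_eq _ _ _ _ (sum_pos_of_mem_posOrthant hx).ne']
    simp [a, Fin.sum_univ_two]
  have hmix := completelyMonotoneOnOrthant_integral_exp (μ := volume) (a := a)
    (fun i => by fin_cases i <;> simp only [a] <;> dsimp <;> fun_prop)
    (fun i t => by fin_cases i <;> simp only [a] <;> dsimp <;> positivity)
    (fun x hx => by
      rw [hexp x hx]
      exact ((integrable_exp_neg_mul_sq (mul_pos hlam
        (sum_pos_of_mem_posOrthant hx))).comp_sub_right _).const_mul _)
  refine ((completelyMonotoneOnOrthant_const_mul_rpow (c := √(lam / Real.pi)) (Real.sqrt_nonneg _)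
    (sub_nonneg.2 hβ)).mul hmix).congr fun x hx => ?_
  have hs := sum_pos_of_mem_posOrthant hx
  simp only [Pi.mul_apply]
  rw [hexp x hx, integral_const_mul,
    integral_sub_right_eq_self (fun t => Real.exp (-(lam * (x 0 + x 1)) * t ^ 2)),
    integral_gaussian]
  have h1 : √(lam / Real.pi) * √(Real.pi / (lam * (x 0 + x 1))) =
      (x 0 + x 1) ^ (-(1 / 2) : ℝ) := by
    rw [← Real.sqrt_mul (by positivity), Real.rpow_neg hs.le, ← Real.sqrt_eq_rpow,
      ← Real.sqrt_inv]
    congr 1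
    field_simp
  have h2 : (x 0 + x 1) ^ (-β) = (x 0 + x 1) ^ (-(β - 1 / 2)) * (x 0 + x 1) ^ (-(1 / 2) : ℝ) := by
    rw [← Real.rpow_add hs]
    congr 1
    ring
  rw [h2, ← h1]
  ring

/-- The rising factorial `β (β + 1) ⋯ (β + n - 1)`. -/
def risingFactorial (β : ℝ) (n : ℕ) : ℝ := ∏ i ∈ Finset.range n, (β + i)

theorem risingFactorial_succ (β : ℝ) (n : ℕ) :
    risingFactorial β (n + 1) = risingFactorial β n * (β + n) := Finset.prod_range_succ _ _

theorem risingFactorial_pos {β : ℝ} (hβ : 0 < β) (n : ℕ) : 0 < risingFactorial β n :=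
  Finset.prod_pos fun _ _ => by positivity

theorem factorial_two_mul_eq_risingFactorial (n : ℕ) :
    ((2 * n).factorial : ℝ) = 4 ^ n * n.factorial * risingFactorial (1 / 2) n := by
  induction n with
  | zero => simp [risingFactorial]
  | succ n ih =>
    rw [risingFactorial_succ, mul_add, mul_one, Nat.factorial_succ, Nat.factorial_succ,
      Nat.factorial_succ]
    push_cast
    rw [ih]
    ring

theorem mul_risingFactorial_le_risingFactorial_half {β : ℝ} (h0 : 0 < β) (h1 : β < 1 / 2) (n : ℕ) :
    (1 + (1 / 2 - β) * ∑ i ∈ Finset.range n, 1 / ((i : ℝ) + 1)) * risingFactorial β n ≤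
      risingFactorial (1 / 2) n := by
  induction n with
  | zero => simp [risingFactorial]
  | succ n ih =>
    have hp := risingFactorial_pos h0 n
    have hS : 0 ≤ ∑ i ∈ Finset.range n, 1 / ((i : ℝ) + 1) :=
      Finset.sum_nonneg fun _ _ => by positivity
    rw [Finset.sum_range_succ, risingFactorial_succ, risingFactorial_succ]
    set S := ∑ i ∈ Finset.range n, 1 / ((i : ℝ) + 1)
    have hε : 0 < 1 / 2 - β := by linarith
    have h2 : (1 + (1 / 2 - β) * (S + 1 / ((n : ℝ) + 1))) * (β + n) ≤
        (1 + (1 / 2 - β) * S) * (1 / 2 + n) := by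
      have h3 : 1 / ((n : ℝ) + 1) * (β + n) ≤ 1 := by
        rw [one_div_mul_eq_div, div_le_one (by positivity)]
        linarith
      have h4 := mul_le_mul_of_nonneg_left h3 hε.le
      have h5 : 0 ≤ (1 / 2 - β) * S * (1 / 2 - β) := by positivity
      linarith
    calc _ = ((1 + (1 / 2 - β) * (S + 1 / ((n : ℝ) + 1))) * (β + n)) * risingFactorial β n := by
          ring
      _ ≤ ((1 + (1 / 2 - β) * S) * (1 / 2 + n)) * risingFactorial β n :=
          mul_le_mul_of_nonneg_right h2 hp.le
      _ = ((1 + (1 / 2 - β) * S) * risingFactorial β n) * (1 / 2 + n) := by ring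
      _ ≤ _ := mul_le_mul_of_nonneg_right ih (by positivity)

/-- For `0 < β < 1/2` the series `∑ z ^ (2 j) / (j! (β)_j)` outgrows `exp (2 z)`. -/
theorem exists_exp_lt_sum_risingFactorial {β : ℝ} (h0 : 0 < β) (h1 : β < 1 / 2) :
    ∃ z > 0, ∃ K : ℕ, Real.exp (2 * z) <
      ∑ j ∈ Finset.range K, z ^ (2 * j) / (j.factorial * risingFactorial β j) := by
  by_contra! hle
  obtain ⟨K, hK⟩ : ∃ K : ℕ, ∀ j ≥ K, 4 * risingFactorial β j ≤ risingFactorial (1 / 2) j := by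
    have hε : 0 < 1 / 2 - β := by linarith
    obtain ⟨K, hK⟩ := eventually_atTop.1
      (Real.tendsto_sum_range_one_div_nat_succ_atTop.eventually_ge_atTop (3 / (1 / 2 - β)))
    refine ⟨K, fun j hj => le_trans (mul_le_mul_of_nonneg_right ?_ (risingFactorial_pos h0 j).le)
      (mul_risingFactorial_le_risingFactorial_half h0 h1 j)⟩
    have := (div_le_iff₀ hε).1 (hK j hj)
    linarith
  have hcosh : ∀ z : ℝ, 0 < z → Real.cosh (2 * z) ≤
      ∑ j ∈ Finset.range K, (2 * z) ^ (2 * j) / ((2 * j).factorial : ℝ) +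
        Real.exp (2 * z) / 4 := by
    intro z hz
    have ht := (tendsto_add_atTop_iff_nat K).2 (Real.hasSum_cosh (2 * z)).tendsto_sum_nat
    refine le_of_tendsto' ht fun M => ?_
    rw [add_comm M K, Finset.sum_range_add]
    refine add_le_add_right ?_ _
    have hterm : ∀ j ≥ K, (2 * z) ^ (2 * j) / ((2 * j).factorial : ℝ) ≤
        z ^ (2 * j) / (j.factorial * risingFactorial β j) / 4 := by
      intro j hj
      have hp := risingFactorial_pos h0 j
      have hf : (0 : ℝ) < j.factorial := by positivity
      rw [factorial_two_mul_eq_risingFactorial, mul_pow, pow_mul 2 2 j, div_div]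
      norm_num only [mul_assoc]
      rw [mul_div_mul_left _ _ (by positivity)]
      refine div_le_div_of_nonneg_left (by positivity) (by positivity)
        (mul_le_mul_of_nonneg_left ?_ hf.le)
      have := hK j hj
      linarith
    calc _ ≤ ∑ j ∈ Finset.range M,
          z ^ (2 * (K + j)) / ((K + j).factorial * risingFactorial β (K + j)) / 4 :=
          Finset.sum_le_sum fun j _ => hterm _ (Nat.le_add_right _ _)
      _ = (∑ j ∈ Finset.range M,
          z ^ (2 * (K + j)) / ((K + j).factorial * risingFactorial β (K + j))) / 4 := by
          rw [Finset.sum_div]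
      _ ≤ _ := by
          refine div_le_div_of_nonneg_right (le_trans ?_ (hle z hz (K + M))) (by norm_num)
          rw [Finset.sum_range_add]
          refine le_add_of_nonneg_left (Finset.sum_nonneg fun j _ => ?_)
          have := risingFactorial_pos h0 j
          positivity
  have hlim : Tendsto (fun y : ℝ => ∑ j ∈ Finset.range K,
      (y ^ (2 * j) * Real.exp (-y)) / ((2 * j).factorial : ℝ)) atTop (𝓝 0) := by
    have := tendsto_finsetSum (Finset.range K) fun j _ =>
      (Real.tendsto_pow_mul_exp_neg_atTop_nhds_zero (2 * j)).div_const ((2 * j).factorial : ℝ)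
    simpa using this
  refine absurd (ge_of_tendsto hlim (b := 1 / 4) ?_) (by norm_num)
  filter_upwards [eventually_gt_atTop 0] with y hy
  have h2 := hcosh (y / 2) (by positivity)
  rw [show 2 * (y / 2) = y by ring, Real.cosh_eq] at h2
  have h3 := Real.exp_pos (-y)
  have h4 : Real.exp y / 4 ≤ ∑ j ∈ Finset.range K, y ^ (2 * j) / ((2 * j).factorial : ℝ) := by
    linarith
  have h5 := mul_le_mul_of_nonneg_right h4 h3.le
  rw [div_mul_eq_mul_div, ← Real.exp_add, add_neg_cancel, Real.exp_zero, Finset.sum_mul] at h5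
  simpa only [div_mul_eq_mul_div] using h5

/-- The kernel `(u + v) ^ (-a) exp (-lam u v / (u + v))`. -/
noncomputable def seriesKernel (lam a u v : ℝ) : ℝ :=
  (u + v) ^ (-a) * Real.exp (-(lam * (u * v) / (u + v)))

theorem hasDerivAt_seriesKernel (lam a u : ℝ) {v : ℝ} (h : 0 < u + v) :
    HasDerivAt (fun t => seriesKernel lam a u t)
      (-(a * seriesKernel lam (a + 1) u v + lam * u ^ 2 * seriesKernel lam (a + 2) u v)) v := by
  have hs : HasDerivAt (fun t => u + t) 1 v := (hasDerivAt_id v).const_add u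
  have hn : HasDerivAt (fun t => lam * (u * t)) (lam * (u * 1)) v :=
    ((hasDerivAt_id v).const_mul u).const_mul lam
  have hq : HasDerivAt (fun t => -(lam * (u * t) / (u + t))) _ v := (hn.div hs h.ne').neg
  refine ((hs.rpow_const (p := -a) (Or.inl h.ne')).mul hq.exp).congr_deriv ?_
  have h1 : (u + v) ^ (-(a + 1)) = (u + v) ^ (-a) / (u + v) := by
    rw [← Real.rpow_sub_one h.ne']
    congr 1
    ring
  have h2 : (u + v) ^ (-(a + 2)) = (u + v) ^ (-a) / (u + v) ^ 2 := by
    rw [← Real.rpow_sub_natCast h.ne']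
    congr 1
    push_cast
    ring
  rw [Real.rpow_sub_one h.ne']
  simp only [seriesKernel, h1, h2]
  field_simp
  ring

/-- The coefficients of `(-∂/∂v)^n` of `seriesKernel`. -/
noncomputable def seriesKernelCoeff (β : ℝ) (n j : ℕ) : ℝ :=
  n.choose j * (risingFactorial β n / risingFactorial β j)

theorem seriesKernelCoeff_succ_zero (β : ℝ) (n : ℕ) :
    seriesKernelCoeff β (n + 1) 0 = (β + n) * seriesKernelCoeff β n 0 := by
  simp [seriesKernelCoeff, risingFactorial_succ]
  ring

theorem seriesKernelCoeff_succ_succ {β : ℝ} (hβ : 0 < β) (n j : ℕ) :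
    seriesKernelCoeff β (n + 1) (j + 1) =
      (β + n + (j + 1 : ℕ)) * seriesKernelCoeff β n (j + 1) + seriesKernelCoeff β n j := by
  have hj := (risingFactorial_pos hβ j).ne'
  have hbj : β + j ≠ 0 := by positivity
  have hc : (n.choose (j + 1) : ℝ) * (j + 1) = n.choose j * (n - j) := by
    rcases le_or_gt j n with h | h
    · rw [← Nat.cast_sub h]
      exact_mod_cast Nat.choose_succ_right_eq n j
    · simp [Nat.choose_eq_zero_of_lt h, Nat.choose_eq_zero_of_lt (h.trans (Nat.lt_succ_self j))]
  simp only [seriesKernelCoeff, risingFactorial_succ, Nat.choose_succ_succ]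
  push_cast
  field_simp
  linear_combination -(risingFactorial β n) * hc

/-- The function `(-∂/∂v)^n` of `seriesKernel lam β`. -/
noncomputable def seriesKernelDeriv (lam β : ℝ) (n : ℕ) (u v : ℝ) : ℝ :=
  ∑ j ∈ Finset.range (n + 1), seriesKernelCoeff β n j * (lam * u ^ 2) ^ j *
    seriesKernel lam (β + n + j) u v

theorem hasDerivAt_seriesKernelDeriv (lam : ℝ) {β : ℝ} (hβ : 0 < β) (n : ℕ) (u : ℝ) {v : ℝ}
    (h : 0 < u + v) :
    HasDerivAt (fun t => seriesKernelDeriv lam β n u t)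
      (-seriesKernelDeriv lam β (n + 1) u v) v := by
  refine (HasDerivAt.fun_sum fun (j : ℕ) _ => (hasDerivAt_seriesKernel lam (β + n + j) u h).const_mul
    (seriesKernelCoeff β n j * (lam * u ^ 2) ^ j)).congr_deriv ?_
  set c := lam * u ^ 2
  let T : ℕ → ℝ := fun j => seriesKernel lam (β + n + 1 + j) u v
  let A := seriesKernelCoeff β n
  have hlast : A (n + 1) = 0 := by simp [A, seriesKernelCoeff]
  have e1 : seriesKernelDeriv lam β (n + 1) u v =
      ∑ j ∈ Finset.range (n + 1), (A j * c ^ j * ((β + n + j) * T j) +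
        A j * c ^ j * (c * T (j + 1))) := by
    rw [Finset.sum_add_distrib]
    have e2 : ∑ j ∈ Finset.range (n + 1), A j * c ^ j * ((β + n + j) * T j) =
        ∑ j ∈ Finset.range (n + 2), A j * c ^ j * ((β + n + j) * T j) := by
      rw [Finset.sum_range_succ _ (n + 1), hlast]
      simp
    rw [e2, Finset.sum_range_succ', seriesKernelDeriv, Finset.sum_range_succ',
      seriesKernelCoeff_succ_zero,
      add_right_comm (Finset.sum _ _), ← Finset.sum_add_distrib]
    congr 1
    · refine Finset.sum_congr rfl fun j _ => ?_
      rw [seriesKernelCoeff_succ_succ hβ]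
      simp only [A, T, c, Nat.cast_add, Nat.cast_one, ← add_assoc]
      ring
    · simp only [A, T, Nat.cast_add, Nat.cast_one, Nat.cast_zero, add_zero, ← add_assoc]
      ring
  rw [e1, ← Finset.sum_neg_distrib]
  refine Finset.sum_congr rfl fun j _ => ?_
  have e3 : seriesKernel lam (β + n + j + 1) u v = T j := by
    simp only [T]
    congr 1
    ring
  have e4 : seriesKernel lam (β + n + j + 2) u v = T (j + 1) := by
    simp only [T]
    congr 1
    push_cast
    ring
  rw [e3, e4]
  ring

theorem IsNegGradOnOrthant.hasDerivAt_update {ι : Type*} [Fintype ι] [DecidableEq ι]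
    {f : (ι → ℝ) → ℝ} {g : ι → (ι → ℝ) → ℝ} (h : IsNegGradOnOrthant f g) {x : ι → ℝ}
    (hx : x ∈ posOrthant ι) (i : ι) :
    HasDerivAt (fun t => f (Function.update x i t)) (-(g i x)) (x i) := by
  have h1 := h x hx
  rw [← Function.update_eq_self i x] at h1
  refine (h1.comp_hasDerivAt (x i) (_root_.hasDerivAt_update x i (x i))).congr_deriv ?_
  simp [Pi.single_apply]

theorem CompletelyMonotoneOnOrthant.seriesKernelDeriv {lam β : ℝ} (hβ : 0 < β)
    (h : CompletelyMonotoneOnOrthant fun x : Fin 2 → ℝ => seriesKernel lam β (x 0) (x 1)) (n : ℕ) :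
    CompletelyMonotoneOnOrthant fun x : Fin 2 → ℝ => seriesKernelDeriv lam β n (x 0) (x 1) := by
  induction n with
  | zero => simpa [_root_.seriesKernelDeriv, seriesKernelCoeff, risingFactorial] using h
  | succ n ih =>
    obtain ⟨g, hg, hgrad⟩ := ih.exists_negGrad
    refine (hg 1).congr fun x hx => ?_
    have h1 := hgrad.hasDerivAt_update hx 1
    simp only [Function.update_self, ne_eq, zero_ne_one, not_false_eq_true,
      Function.update_of_ne] at h1
    exact neg_injective
      ((hasDerivAt_seriesKernelDeriv lam hβ n (x 0) (sum_pos_of_mem_posOrthant hx)).unique h1)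

theorem seriesKernelDeriv_zero_left (lam β : ℝ) (n : ℕ) (v : ℝ) :
    seriesKernelDeriv lam β n 0 v = risingFactorial β n * v ^ (-(β + n)) := by
  rw [seriesKernelDeriv, Finset.sum_eq_single_of_mem 0 (by simp) fun j _ hj => by simp [hj]]
  simp [seriesKernelCoeff, seriesKernel, risingFactorial]

theorem continuousAt_seriesKernelDeriv (lam β : ℝ) (n : ℕ) {u v : ℝ} (h : u + v ≠ 0) :
    ContinuousAt (fun u => seriesKernelDeriv lam β n u v) u := by
  unfold seriesKernelDeriv seriesKernel
  refine tendsto_finsetSum _ fun j _ => ?_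
  have hs : ContinuousAt (fun u => u + v) u := by fun_prop
  refine ContinuousAt.mul (by fun_prop) ((hs.rpow_const (Or.inl h)).mul ?_)
  exact (ContinuousAt.div (by fun_prop) hs h).neg.rexp

theorem CompletelyMonotoneOnOrthant.seriesKernelDeriv_le {lam β : ℝ} (hβ : 0 < β)
    (h : CompletelyMonotoneOnOrthant fun x : Fin 2 → ℝ => seriesKernel lam β (x 0) (x 1)) (n : ℕ)
    {u v : ℝ} (hu : 0 < u) (hv : 0 < v) :
    _root_.seriesKernelDeriv lam β n u v ≤ risingFactorial β n * v ^ (-(β + n)) := by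
  obtain ⟨g, hg, hgrad⟩ := (h.seriesKernelDeriv hβ n).exists_negGrad
  have hmem : ∀ w : ℝ, 0 < w → ![w, v] ∈ posOrthant (Fin 2) := fun w hw i => by
    fin_cases i <;> simpa
  have hd : ∀ w : ℝ, 0 < w →
      HasDerivAt (fun w => _root_.seriesKernelDeriv lam β n w v) (-(g 0 ![w, v])) w := by
    intro w hw
    simpa using hgrad.hasDerivAt_update (hmem w hw) 0
  have hanti : AntitoneOn (fun w => _root_.seriesKernelDeriv lam β n w v) (Set.Ioi 0) := by
    refine antitoneOn_of_deriv_nonpos (convex_Ioi 0)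
      (fun w hw => (hd w hw).continuousAt.continuousWithinAt)
      (fun w hw => (hd w (interior_subset hw)).differentiableAt.differentiableWithinAt)
      fun w hw => ?_
    have hw' : 0 < w := interior_subset hw
    rw [(hd w hw').deriv]
    exact neg_nonpos.2 ((hg 0).nonneg (hmem w hw'))
  rw [← seriesKernelDeriv_zero_left lam]
  refine ge_of_tendsto ((continuousAt_seriesKernelDeriv lam β n (u := 0) (v := v)
    (by simpa using hv.ne')).tendsto.mono_left (nhdsWithin_le_nhds (s := Set.Ioi 0))) ?_
  filter_upwards [Ioo_mem_nhdsGT hu] with w hw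
  exact hanti hw.1 hu hw.2.le

theorem seriesKernelDeriv_eq (lam β : ℝ) (n : ℕ) {u v : ℝ} (h : 0 < u + v) :
    seriesKernelDeriv lam β n u v = risingFactorial β n * seriesKernel lam (β + n) u v *
      ∑ j ∈ Finset.range (n + 1), n.choose j * (1 / (u + v)) ^ j *
        ((lam * u ^ 2) ^ j / risingFactorial β j) := by
  rw [seriesKernelDeriv, Finset.mul_sum]
  refine Finset.sum_congr rfl fun j _ => ?_
  have h1 : (u + v) ^ (-(β + n + j)) = (u + v) ^ (-(β + n)) * (1 / (u + v)) ^ j := by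
    rw [neg_add, ← sub_eq_add_neg, Real.rpow_sub_natCast h.ne', one_div, inv_pow, div_eq_mul_inv]
  simp only [seriesKernel, seriesKernelCoeff, h1]
  ring

theorem CompletelyMonotoneOnOrthant.sum_choose_le {lam β : ℝ} (hlam : 0 < lam) (hβ : 0 < β)
    (h : CompletelyMonotoneOnOrthant fun x : Fin 2 → ℝ => seriesKernel lam β (x 0) (x 1))
    {n K : ℕ} (hK : K ≤ n + 1) {u v : ℝ} (hu : 0 < u) (hv : 0 < v) :
    ∑ j ∈ Finset.range K, n.choose j * (1 / (u + v)) ^ j *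
        ((lam * u ^ 2) ^ j / risingFactorial β j) ≤
      Real.exp (lam * u + u / v * (β + n)) := by
  have hs : 0 < u + v := add_pos hu hv
  have hp := risingFactorial_pos hβ
  have h1 := h.seriesKernelDeriv_le hβ n hu hv
  rw [seriesKernelDeriv_eq lam β n hs, mul_assoc] at h1
  have h2 := le_of_mul_le_mul_left h1 (hp n)
  have h3 : v ^ (-(β + n)) ≤
      seriesKernel lam (β + n) u v * Real.exp (lam * u + u / v * (β + n)) := by
    have h4 : (u + v) ^ (β + n) ≤ v ^ (β + n) * Real.exp (u / v * (β + n)) := by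
      rw [Real.exp_mul, ← Real.mul_rpow hv.le (Real.exp_pos _).le]
      refine Real.rpow_le_rpow hs.le ?_ (by positivity)
      have := mul_le_mul_of_nonneg_left (Real.add_one_le_exp (u / v)) hv.le
      rwa [mul_add, mul_one, mul_div_cancel₀ _ hv.ne'] at this
    have h5 : 1 ≤ Real.exp (-(lam * (u * v) / (u + v))) * Real.exp (lam * u) := by
      rw [← Real.exp_add, Real.one_le_exp_iff, neg_add_eq_sub, sub_nonneg, div_le_iff₀ hs]
      have : 0 < lam * u * u := by positivity
      linarith
    have h6 : v ^ (-(β + n)) ≤ (u + v) ^ (-(β + n)) * Real.exp (u / v * (β + n)) := by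
      rw [Real.rpow_neg hv.le, Real.rpow_neg hs.le, inv_mul_eq_div,
        le_div_iff₀ (Real.rpow_pos_of_pos hs _), inv_mul_le_iff₀ (Real.rpow_pos_of_pos hv _)]
      exact h4
    refine h6.trans ?_
    rw [seriesKernel, Real.exp_add]
    have h7 : 0 ≤ (u + v) ^ (-(β + n)) * Real.exp (u / v * (β + n)) := by positivity
    nlinarith [mul_le_mul_of_nonneg_left h5 h7]
  have hpos : 0 < seriesKernel lam (β + n) u v :=
    mul_pos (Real.rpow_pos_of_pos hs _) (Real.exp_pos _)
  refine le_trans ?_ (le_of_mul_le_mul_left (h2.trans h3) hpos)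
  refine Finset.sum_le_sum_of_subset_of_nonneg (Finset.range_subset_range.2 hK) fun j _ _ => ?_
  have := hp j
  positivity

theorem CompletelyMonotoneOnOrthant.sum_risingFactorial_le_exp {lam β : ℝ} (hlam : 0 < lam)
    (hβ : 0 < β)
    (h : CompletelyMonotoneOnOrthant fun x : Fin 2 → ℝ => seriesKernel lam β (x 0) (x 1))
    {z : ℝ} (hz : 0 < z) (K : ℕ) :
    ∑ j ∈ Finset.range K, z ^ (2 * j) / (j.factorial * risingFactorial β j) ≤
      Real.exp (2 * z) := by
  have hu : 0 < z / lam := div_pos hz hlam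
  have hinv : Tendsto (fun n : ℕ => (n : ℝ)⁻¹) atTop (𝓝 0) := tendsto_inv_atTop_nhds_zero_nat
  have hp : Tendsto (fun n : ℕ => (n : ℝ) * (1 / (z / lam + n / lam))) atTop (𝓝 lam) := by
    have h1 : Tendsto (fun n : ℕ => lam / (z * (n : ℝ)⁻¹ + 1)) atTop (𝓝 (lam / (z * 0 + 1))) :=
      tendsto_const_nhds.div ((hinv.const_mul z).add_const 1) (by simp)
    rw [mul_zero, zero_add, div_one] at h1
    refine h1.congr' ?_
    filter_upwards [eventually_gt_atTop 0] with n hn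
    have : (0 : ℝ) < n := by exact_mod_cast hn
    field_simp
  have hleft := tendsto_finsetSum (Finset.range K) fun j _ =>
    (ProbabilityTheory.tendsto_choose_mul_pow_atTop j hp).mul_const
      ((lam * (z / lam) ^ 2) ^ j / risingFactorial β j)
  have hright : Tendsto (fun n : ℕ => Real.exp (z + (β * z * (n : ℝ)⁻¹ + z))) atTop
      (𝓝 (Real.exp (z + (β * z * 0 + z)))) :=
    (Real.continuous_exp.tendsto _).comp (((hinv.const_mul (β * z)).add_const z).const_add z)
  have key := le_of_tendsto_of_tendsto hleft hright ?_
  · refine ((Finset.sum_congr rfl fun j _ => ?_).trans_le key).trans_eq (by ring_nf)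
    have e : z ^ (2 * j) = lam ^ j * (lam * (z / lam) ^ 2) ^ j := by
      rw [← mul_pow, pow_mul]
      congr 1
      field_simp
    rw [e, div_mul_div_comm]
  · filter_upwards [eventually_gt_atTop 0, eventually_ge_atTop K] with n hn hKn
    have hn' : (0 : ℝ) < n := by exact_mod_cast hn
    refine (h.sum_choose_le hlam hβ (hKn.trans (Nat.le_succ n)) hu
      (div_pos hn' hlam)).trans_eq ?_
    congr 1
    field_simp

theorem CompletelyMonotoneOnOrthant.half_le_of_seriesKernel {lam β : ℝ} (hlam : 0 < lam)
    (h : CompletelyMonotoneOnOrthant fun x : Fin 2 → ℝ => seriesKernel lam β (x 0) (x 1)) :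
    1 / 2 ≤ β := by
  by_contra! hβ
  obtain ⟨γ, hγ0, hγ1, hβγ⟩ : ∃ γ : ℝ, 0 < γ ∧ γ < 1 / 2 ∧ β ≤ γ :=
    ⟨max β (1 / 4), by positivity, max_lt hβ (by norm_num), le_max_left _ _⟩
  have hγ : CompletelyMonotoneOnOrthant fun x : Fin 2 → ℝ => seriesKernel lam γ (x 0) (x 1) := by
    refine ((completelyMonotoneOnOrthant_const_mul_rpow zero_le_one (sub_nonneg.2 hβγ)).mul
      h).congr fun x hx => ?_
    simp only [Pi.mul_apply, seriesKernel, one_mul]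
    rw [← mul_assoc ((x 0 + x 1) ^ (-(γ - β))), ← Real.rpow_add (sum_pos_of_mem_posOrthant hx)]
    congr 2
    ring
  obtain ⟨z, hz, K, hlt⟩ := exists_exp_lt_sum_risingFactorial hγ0 hγ1
  exact (hγ.sum_risingFactorial_le_exp hlam hγ0 hz K).not_gt hlt

end Kernel

/-- For `β ∈ ℝ` and `λ > 0`, the function
`F(u,v) = (u+v)^{-β} exp(−λ uv/(u+v))` is completely monotone on `(0,∞)²` iff `β ≥ 1/2`. -/
theorem completely_monotone_series_kernel_iff (β lam : ℝ) (hlam : 0 < lam) :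
    CompletelyMonotoneOnOrthant
      (fun x : Fin 2 → ℝ =>
        (x 0 + x 1) ^ (-β) * Real.exp (-(lam * (x 0 * x 1) / (x 0 + x 1))))
      ↔ (1 : ℝ) / 2 ≤ β :=
  ⟨fun h => h.half_le_of_seriesKernel hlam, completelyMonotoneOnOrthant_kernel hlam⟩
end
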